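/- Let x = x(t) = 2(t/(2π))^{3/2} and define I₁ = ∑_{k=1}^{∞} d₃(k) k^{−1/2} ∫_T^{2T} ρ(k/x(t)) k^{−it} χ(1/2+it)^{−1} dt. Then for large T, I₁ = 2π ∑'_{T/(2π) ≤ k ≤ T/π} d₃(k) + O(T^{3/4} log² T). -/

import Mathlib

open Complex Filter Real MeasureTheory Finset

noncomputable def chi (s : ℂ) : ℂ :=
  2 ^ s * (π : ℂ) ^ (s - 1) * Complex.sin (π * s / 2) * Complex.Gamma (1 - s)

noncomputable def Z (t : ℝ) : ℂ :=
  chi (1 / 2 + I * t) ^ (-(1 / 2 : ℂ)) * riemannZeta (1 / 2 + I * t)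

/-- number of positive divisors -/
noncomputable def d (k : ℕ) : ℕ := k.divisors.card

/-- number of ordered triples of positive integers with product `n` -/
noncomputable def d3 (n : ℕ) : ℕ :=
  ((Finset.Icc 1 n ×ˢ Finset.Icc 1 n ×ˢ Finset.Icc 1 n).filter
    fun p : ℕ × ℕ × ℕ => p.1 * p.2.1 * p.2.2 = n).card

/-- sum over integers `a ≤ k ≤ b` where terms at integer endpoints are halved -/
noncomputable def psum (a b : ℝ) (f : ℕ → ℂ) : ℂ :=
  ∑ k ∈ Finset.Icc ⌈a⌉₊ ⌊b⌋₊,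
    (if (k : ℝ) = a ∨ (k : ℝ) = b then (1 / 2 : ℂ) else 1) * f k

/-- The logarithm of the main term `s ^ (s - 1 / 2) * exp (-s)` in Stirling's formula. -/
noncomputable def stirlingLog (s : ℂ) : ℂ := (s - 1 / 2) * Complex.log s - s

/-- The amount by which `stirlingLog (s + 1)` exceeds `stirlingLog s + log s`. -/
noncomputable def stirlingDefect (s : ℂ) : ℂ :=
  (s + 1 / 2) * (Complex.log (s + 1) - Complex.log s) - 1

lemma log_add_one_sub_log {s : ℂ} (hs : 0 < s.re) :
    Complex.log (s + 1) - Complex.log s = Complex.log (1 + 1 / s) := by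
  have hs0 : s ≠ 0 := by rintro rfl; simp at hs
  have hre : 0 < (1 + 1 / s).re := by
    have : 0 < (1 / s).re := by
      rw [one_div, Complex.inv_re]
      exact div_pos hs (Complex.normSq_pos.mpr hs0)
    simp only [Complex.add_re, Complex.one_re]
    linarith
  have h1 : |s.arg| < π / 2 := Complex.abs_arg_lt_pi_div_two_iff.mpr (Or.inl hs)
  have h2 : |(1 + 1 / s).arg| < π / 2 := Complex.abs_arg_lt_pi_div_two_iff.mpr (Or.inl hre)
  rw [abs_lt] at h1 h2
  have hne : 1 + 1 / s ≠ 0 := by intro h; rw [h] at hre; simp at hre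
  have := Complex.log_mul hs0 hne ⟨by linarith [h1.1, h2.1], by linarith [h1.2, h2.2]⟩
  rw [show s + 1 = s * (1 + 1 / s) by field_simp, this]
  ring

lemma norm_stirlingDefect_le {s : ℂ} (hs : 0 < s.re) (hs2 : 2 ≤ ‖s‖) :
    ‖stirlingDefect s‖ ≤ 2 / ‖s‖ ^ 2 := by
  have hs0 : s ≠ 0 := by rintro rfl; simp at hs
  have hpos : 0 < ‖s‖ := by linarith
  have hz : ‖1 / s‖ ≤ 1 / 2 := by
    rw [norm_div, norm_one]
    exact one_div_le_one_div_of_le (by norm_num) hs2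
  have hlog := Complex.norm_log_sub_logTaylor_le 2 (z := 1 / s) (by linarith)
  have hT : Complex.logTaylor (2 + 1) (1 / s) = 1 / s - (1 / s) ^ 2 / 2 := by
    simp [Complex.logTaylor_succ, Complex.logTaylor_zero]
    ring
  rw [hT] at hlog
  set r := Complex.log (1 + 1 / s) - (1 / s - (1 / s) ^ 2 / 2) with hr
  have hr3 : ‖r‖ ≤ 2 / 3 * (1 / ‖s‖) ^ 3 := by
    refine hlog.trans ?_
    have h1 : (1 - ‖1 / s‖)⁻¹ ≤ 2 := by
      rw [inv_le_comm₀ (by linarith) (by norm_num)]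
      linarith
    have h2 : ‖1 / s‖ = 1 / ‖s‖ := by simp
    rw [h2] at h1 ⊢
    have h3 : 0 ≤ (1 / ‖s‖) ^ 3 := by positivity
    push_cast
    rw [div_le_iff₀ (by norm_num)]
    refine (mul_le_mul_of_nonneg_left h1 h3).trans (le_of_eq ?_)
    ring
  have key : stirlingDefect s = (s + 1 / 2) * r - 1 / (4 * s ^ 2) := by
    rw [stirlingDefect, log_add_one_sub_log hs,
      show Complex.log (1 + 1 / s) = r + (1 / s - (1 / s) ^ 2 / 2) by rw [hr]; ring]
    field_simp
    ring
  have h1 : ‖s + 1 / 2‖ ≤ 5 / 4 * ‖s‖ := by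
    refine (norm_add_le _ _).trans ?_
    norm_num
    linarith
  have h2 : ‖1 / (4 * s ^ 2)‖ = 1 / 4 * (1 / ‖s‖) ^ 2 := by
    simp; ring
  rw [key]
  calc ‖(s + 1 / 2) * r - 1 / (4 * s ^ 2)‖ ≤ ‖s + 1 / 2‖ * ‖r‖ + ‖1 / (4 * s ^ 2)‖ := by
        rw [← norm_mul]; exact norm_sub_le _ _
    _ ≤ 5 / 4 * ‖s‖ * (2 / 3 * (1 / ‖s‖) ^ 3) + 1 / 4 * (1 / ‖s‖) ^ 2 := by
        rw [h2]; gcongr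
    _ = 13 / 12 / ‖s‖ ^ 2 := by field_simp; norm_num
    _ ≤ 2 / ‖s‖ ^ 2 := by gcongr; norm_num

lemma add_natCast_ne_zero {s : ℂ} (hs : 0 < s.re) (n : ℕ) : s + n ≠ 0 := by
  intro h
  have := congrArg Complex.re h
  simp at this
  have : (0 : ℝ) ≤ n := n.cast_nonneg
  linarith

lemma Gamma_add_natCast_eq_prod {s : ℂ} (hs : 0 < s.re) (n : ℕ) :
    Complex.Gamma (s + n) = Complex.Gamma s * ∏ j ∈ range n, (s + j) := by
  induction n with
  | zero => simp
  | succ n ih =>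
    rw [prod_range_succ, ← mul_assoc, ← ih, Nat.cast_succ, ← add_assoc,
      Complex.Gamma_add_one _ (add_natCast_ne_zero hs n), mul_comm]

lemma Gamma_add_natCast_mul_exp {s : ℂ} (hs : 0 < s.re) (n : ℕ) :
    Complex.Gamma (s + n) * Complex.exp (-stirlingLog (s + n)) =
      Complex.Gamma s * Complex.exp (-stirlingLog s - ∑ j ∈ range n, stirlingDefect (s + j)) := by
  induction n with
  | zero => simp
  | succ n ih =>
    have hne := add_natCast_ne_zero hs n
    have h : stirlingLog (s + n + 1) =
        stirlingLog (s + n) + Complex.log (s + n) + stirlingDefect (s + n) := by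
      simp only [stirlingLog, stirlingDefect]; ring
    rw [sum_range_succ, ← sub_sub, Complex.exp_sub, ← mul_div_assoc, ← ih, Nat.cast_succ,
      ← add_assoc, Complex.Gamma_add_one _ hne, h, neg_add, neg_add, Complex.exp_add,
      Complex.exp_add, Complex.exp_neg (Complex.log _), Complex.exp_log hne,
      Complex.exp_neg (stirlingDefect _)]
    field_simp

lemma tendsto_Gamma_mul_exp_neg_stirlingLog {s : ℂ} (hs : 0 < s.re) :
    Tendsto (fun n : ℕ => Complex.Gamma (s + n) * Complex.exp (-stirlingLog (s + n))) atTop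
      (nhds ((√(2 * π) : ℝ) : ℂ)) := by
  rw [← tendsto_add_atTop_iff_nat 1]
  have hG0 : Complex.Gamma s ≠ 0 := Complex.Gamma_ne_zero_of_re_pos hs
  have h1 : Tendsto (fun n : ℕ => Complex.Gamma s / Complex.GammaSeq s n) atTop (nhds 1) := by
    have := (tendsto_const_nhds (x := Complex.Gamma s)).div (Complex.GammaSeq_tendsto_Gamma s) hG0
    rwa [div_self hG0] at this
  have h2 : Tendsto (fun n : ℕ => ((Stirling.stirlingSeq n : ℝ) : ℂ)) atTop
      (nhds ((√π : ℝ) : ℂ)) :=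
    (Complex.continuous_ofReal.tendsto _).comp Stirling.tendsto_stirlingSeq_sqrt_pi
  have hinv : Tendsto (fun n : ℕ => (s + 1) / (n : ℂ)) atTop (nhds 0) :=
    tendsto_const_div_atTop_nhds_zero_nat (s + 1)
  have h3 : Tendsto (fun n : ℕ => (n : ℂ) * Complex.log (1 + (s + 1) / n)) atTop
      (nhds (s + 1)) := by
    apply Complex.tendsto_nat_mul_log_one_add_of_tendsto
    refine tendsto_const_nhds.congr' ?_
    filter_upwards [eventually_ne_atTop 0] with n hn
    have : (n : ℂ) ≠ 0 := by exact_mod_cast hn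
    field_simp
  have h4 : Tendsto (fun n : ℕ => Complex.log (1 + (s + 1) / n)) atTop (nhds 0) := by
    have : Tendsto (fun n : ℕ => 1 + (s + 1) / (n : ℂ)) atTop (nhds 1) := by
      simpa using hinv.const_add 1
    simpa using this.clog (by simp)
  have h5 : Tendsto (fun n : ℕ => Complex.exp ((s + 1) -
      ((n : ℂ) * Complex.log (1 + (s + 1) / n) + (s + 1 / 2) * Complex.log (1 + (s + 1) / n))))
      atTop (nhds 1) := by
    have := (tendsto_const_nhds (x := s + 1)).sub (h3.add (h4.const_mul (s + 1 / 2)))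
    have h := (Complex.continuous_exp.tendsto _).comp this
    rwa [mul_zero, add_zero, sub_self, Complex.exp_zero] at h
  have h6 := ((h1.mul h2).mul h5).mul_const ((√2 : ℝ) : ℂ)
  have e : (1 : ℂ) * ((√π : ℝ) : ℂ) * 1 * ((√2 : ℝ) : ℂ) = ((√(2 * π) : ℝ) : ℂ) := by
    rw [Real.sqrt_mul (by norm_num)]; push_cast; ring
  rw [e] at h6
  refine h6.congr' ?_
  filter_upwards [eventually_ne_atTop 0] with n hn
  have hn0 : (n : ℂ) ≠ 0 := by exact_mod_cast hn
  have hnpos : (0 : ℝ) < n := by exact_mod_cast Nat.pos_of_ne_zero hn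
  have hre : 0 < (1 + (s + 1) / (n : ℂ)).re := by
    rw [Complex.add_re, Complex.div_natCast_re]
    simp only [Complex.one_re, Complex.add_re]
    positivity
  have hne : 1 + (s + 1) / (n : ℂ) ≠ 0 := by intro h; rw [h] at hre; simp at hre
  have hlog : Complex.log (s + (n + 1 : ℕ)) =
      (Real.log n : ℝ) + Complex.log (1 + (s + 1) / n) := by
    rw [← Complex.log_ofReal_mul hnpos hne]
    congr 1
    push_cast
    field_simp
    ring
  have hprod : ∏ j ∈ range (n + 1), (s + (j : ℂ)) ≠ 0 :=
    prod_ne_zero_iff.mpr fun j _ => add_natCast_ne_zero hs j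
  have hfact : (n.factorial : ℂ) ≠ 0 := by exact_mod_cast n.factorial_ne_zero
  have hcpow : (n : ℂ) ^ s = Complex.exp (s * (Real.log n : ℝ)) := by
    rw [Complex.cpow_def_of_ne_zero hn0, Complex.natCast_log, mul_comm]
  have hst : ((Stirling.stirlingSeq n : ℝ) : ℂ) * ((√2 : ℝ) : ℂ) =
      n.factorial / Complex.exp ((1 / 2 + n) * (Real.log n : ℝ) - n) := by
    have : Real.exp ((1 / 2 + n) * Real.log n - n) = √n * (n / Real.exp 1) ^ n := by
      rw [add_mul, add_sub_assoc, Real.exp_add, div_pow, ← Real.exp_nat_mul, Real.exp_sub,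
        mul_one, Real.exp_nat_mul, Real.exp_log hnpos, Real.sqrt_eq_rpow,
        Real.rpow_def_of_pos hnpos, mul_comm (Real.log _)]
    have h' : Stirling.stirlingSeq n * √2 =
        n.factorial / Real.exp ((1 / 2 + n) * Real.log n - n) := by
      rw [this, Stirling.stirlingSeq, Real.sqrt_mul (by norm_num)]
      have : (√2 : ℝ) ≠ 0 := by positivity
      field_simp
    have := congrArg (fun x : ℝ => (x : ℂ)) h'
    push_cast at this ⊢
    exact this
  rw [Gamma_add_natCast_eq_prod hs, Complex.GammaSeq, hcpow, stirlingLog, hlog]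
  rw [show ∀ a b c d : ℂ, a * b * c * d = a * c * (b * d) by intros; ring, hst]
  set l := Complex.log (1 + (s + 1) / n)
  set r : ℂ := ((Real.log n : ℝ) : ℂ)
  set P := ∏ j ∈ range (n + 1), (s + (j : ℂ))
  rw [show -((s + ((n + 1 : ℕ) : ℂ) - 1 / 2) * (r + l) - (s + ((n + 1 : ℕ) : ℂ))) =
    ((s + 1) - (n * l + (s + 1 / 2) * l)) - s * r - ((1 / 2 + n) * r - n) by push_cast; ring,
    Complex.exp_sub _ ((1 / 2 + n) * r - n), Complex.exp_sub _ (s * r)]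
  field_simp

lemma norm_add_natCast_sq_ge {s : ℂ} (hs : 0 < s.re) (n : ℕ) :
    (‖s‖ + n) ^ 2 / 2 ≤ ‖s + n‖ ^ 2 ∧ ‖s‖ ≤ ‖s + n‖ := by
  have h : ‖s + n‖ ^ 2 = ‖s‖ ^ 2 + 2 * n * s.re + n ^ 2 := by
    rw [← Complex.normSq_eq_norm_sq, ← Complex.normSq_eq_norm_sq, Complex.normSq_apply,
      Complex.normSq_apply]
    simp
    ring
  have : 0 ≤ 2 * n * s.re := by positivity
  refine ⟨by rw [h]; nlinarith [sq_nonneg (‖s‖ - n)], ?_⟩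
  refine (sq_le_sq₀ (norm_nonneg _) (norm_nonneg _)).mp ?_
  nlinarith [sq_nonneg (n : ℝ)]

/-- Stirling's formula in the right half plane, with relative error `O(1 / |s|)`. -/
lemma exists_Gamma_eq_stirling {s : ℂ} (hs : 0 < s.re) (hs2 : 2 ≤ ‖s‖) :
    ∃ R : ℂ, ‖R‖ ≤ 8 / ‖s‖ ∧
      Complex.Gamma s = (√(2 * π) : ℝ) * Complex.exp (stirlingLog s + R) := by
  have hterm : ∀ j : ℕ, ‖stirlingDefect (s + j)‖ ≤
      4 * (1 / (‖s‖ + j - 1) - 1 / (‖s‖ + (j + 1 : ℕ) - 1)) := by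
    intro j
    have hj : (0 : ℝ) ≤ j := j.cast_nonneg
    obtain ⟨h1, h2⟩ := norm_add_natCast_sq_ge hs j
    have h5 : 0 < ‖s + j‖ := by linarith
    refine (norm_stirlingDefect_le (by simp; linarith) (hs2.trans h2)).trans ?_
    have h3 : 0 < ‖s‖ + j - 1 := by linarith
    have h4 : 0 < ‖s‖ + j := by linarith
    push_cast
    rw [show ‖s‖ + (j + 1) - 1 = ‖s‖ + j by ring, div_sub_div _ _ h3.ne' h4.ne', ← mul_div_assoc,
      div_le_div_iff₀ (by positivity) (by positivity)]
    nlinarith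
  have hsum : ∀ n : ℕ, ∑ j ∈ range n, ‖stirlingDefect (s + j)‖ ≤ 8 / ‖s‖ := by
    intro n
    refine (sum_le_sum fun j _ => hterm j).trans ?_
    rw [← mul_sum, sum_range_sub' (fun j : ℕ => 1 / (‖s‖ + j - 1))]
    have h3 : 0 ≤ 1 / (‖s‖ + n - 1) := by
      have : (0 : ℝ) ≤ n := n.cast_nonneg
      apply one_div_nonneg.mpr; linarith
    have h4 : 1 / (‖s‖ + (0 : ℕ) - 1) ≤ 2 / ‖s‖ := by
      rw [div_le_div_iff₀ (by simp; linarith) (by linarith)]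
      simp; linarith
    have : 8 / ‖s‖ = 4 * (2 / ‖s‖) := by ring
    linarith
  have hsummable : Summable fun j : ℕ => ‖stirlingDefect (s + j)‖ :=
    summable_of_sum_range_le (fun _ => norm_nonneg _) hsum
  refine ⟨∑' j : ℕ, stirlingDefect (s + j),
    (norm_tsum_le_tsum_norm hsummable).trans (hsummable.tsum_le_of_sum_range_le hsum), ?_⟩
  have hlim := hsummable.of_norm.hasSum.tendsto_sum_nat
  have h1 := (Complex.continuous_exp.tendsto _).comp
    ((tendsto_const_nhds (x := -stirlingLog s)).sub hlim)
  have h2 := h1.const_mul (Complex.Gamma s)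
  have h3 := tendsto_Gamma_mul_exp_neg_stirlingLog hs
  simp_rw [Gamma_add_natCast_mul_exp hs] at h3
  have h4 := tendsto_nhds_unique h3 h2
  rw [h4, mul_assoc, ← Complex.exp_add]
  simp

/-- The phase `t * log (t / κ) - t`, which is stationary at `t = κ`. -/
noncomputable def phase (κ t : ℝ) : ℝ := t * Real.log (t / κ) - t

lemma log_half_sub_mul_I {t : ℝ} (ht : 1 ≤ t) :
    Complex.log (1 / 2 - I * t) =
      (Real.log t : ℝ) - π / 2 * I + Complex.log (1 + I / (2 * t)) := by
  have ht0 : 0 < t := by linarith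
  have htc : (t : ℂ) ≠ 0 := by exact_mod_cast ht0.ne'
  set z : ℂ := 1 + I / (2 * t) with hz
  have hzre : z.re = 1 := by
    rw [hz, show I / (2 * (t : ℂ)) = ((1 / (2 * t) : ℝ) : ℂ) * I by push_cast; field_simp]
    rw [Complex.add_re, Complex.re_ofReal_mul]
    simp
  have hz0 : z ≠ 0 := by intro h; rw [h] at hzre; simp at hzre
  have harg : |z.arg| < π / 2 := Complex.abs_arg_lt_pi_div_two_iff.mpr (Or.inl (by simp [hzre]))
  rw [abs_lt] at harg
  have hprod : (1 / 2 - I * t : ℂ) = t * (-I * z) := by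
    rw [hz]; field_simp; ring_nf; simp; ring
  rw [hprod, Complex.log_ofReal_mul ht0 (mul_ne_zero (neg_ne_zero.mpr I_ne_zero) hz0),
    Complex.log_mul (neg_ne_zero.mpr I_ne_zero) hz0, Complex.log_neg_I]
  · ring
  · rw [Complex.arg_neg_I]
    constructor <;> linarith [harg.1, harg.2, Real.pi_pos]

lemma Gamma_half_sub_mul_I {t : ℝ} (ht : 2 ≤ t) :
    ∃ R : ℂ, ‖R‖ ≤ 9 / t ∧ Complex.Gamma (1 / 2 - I * t) =
      (√(2 * π) : ℝ) *
        Complex.exp (-I * (t * (Real.log t : ℝ)) + I * t - ((π * t / 2 : ℝ) : ℂ) + R) := by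
  have ht0 : 0 < t := by linarith
  have htc : (t : ℂ) ≠ 0 := by exact_mod_cast ht0.ne'
  have hnorm : t ≤ ‖(1 / 2 - I * t : ℂ)‖ := by
    have := Complex.abs_im_le_norm (1 / 2 - I * t : ℂ)
    simp only [Complex.sub_im, Complex.mul_im] at this
    simp [abs_of_pos ht0] at this ⊢
    exact this
  obtain ⟨R, hR, hG⟩ := exists_Gamma_eq_stirling (s := 1 / 2 - I * t) (by simp) (ht.trans hnorm)
  set z : ℂ := I / (2 * t) with hz
  have hzn : ‖z‖ = 1 / (2 * t) := by
    rw [hz]; simp [abs_of_pos ht0]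
  have hz2 : ‖z‖ ≤ 1 / 2 := by
    rw [hzn]; apply one_div_le_one_div_of_le <;> linarith
  set r := Complex.log (1 + z) - z with hr
  have hrn : ‖r‖ ≤ (1 / (2 * t)) ^ 2 := by
    refine (Complex.norm_log_one_add_sub_self_le (by linarith)).trans ?_
    have h1 : (1 - ‖z‖)⁻¹ ≤ 2 := by
      rw [inv_le_comm₀ (by linarith) (by norm_num)]
      linarith
    rw [← hzn]
    nlinarith [sq_nonneg ‖z‖]
  refine ⟨R - I * t * r, ?_, ?_⟩
  · calc ‖R - I * t * r‖ ≤ ‖R‖ + t * ‖r‖ := by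
          refine (norm_sub_le _ _).trans (le_of_eq ?_)
          simp [abs_of_pos ht0]
      _ ≤ 8 / t + t * (1 / (2 * t)) ^ 2 := by
          gcongr
          exact hR.trans (by gcongr)
      _ = (8 + 1 / 4) / t := by field_simp; ring
      _ ≤ 9 / t := by gcongr; norm_num
  · rw [hG, stirlingLog, log_half_sub_mul_I (by linarith)]
    congr 2
    rw [show Complex.log (1 + I / (2 * (t : ℂ))) = r + z by rw [hr, hz]; ring, hz]
    push_cast
    field_simp
    ring_nf
    simp only [Complex.I_sq]
    ring

lemma sin_pi_mul_half_add {t : ℝ} :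
    Complex.sin (π * (1 / 2 + I * t) / 2) = 1 / 2 * Complex.exp (π / 4 * I) *
      Complex.exp ((π * t / 2 : ℝ) : ℂ) * (1 - I * ((Real.exp (-(π * t)) : ℝ) : ℂ)) := by
  have e1 : Complex.exp (-(π * (1 / 2 + I * t) / 2) * I) =
      -I * (Complex.exp (π / 4 * I) * Complex.exp ((π * t / 2 : ℝ) : ℂ)) := by
    rw [← Complex.exp_neg_pi_div_two_mul_I, ← Complex.exp_add, ← Complex.exp_add]
    congr 1
    push_cast
    ring_nf
    simp only [Complex.I_sq]
    ring
  have e2 : Complex.exp (π * (1 / 2 + I * t) / 2 * I) =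
      Complex.exp (π / 4 * I) * Complex.exp ((π * t / 2 : ℝ) : ℂ) *
        ((Real.exp (-(π * t)) : ℝ) : ℂ) := by
    rw [Complex.ofReal_exp, ← Complex.exp_add, ← Complex.exp_add]
    congr 1
    push_cast
    ring_nf
    simp only [Complex.I_sq]
    ring
  rw [Complex.sin, e1, e2]
  ring_nf
  simp only [Complex.I_sq]
  ring

lemma two_cpow_mul_pi_cpow (t : ℝ) :
    (2 : ℂ) ^ (1 / 2 + I * t : ℂ) * (π : ℂ) ^ (1 / 2 + I * t - 1 : ℂ) * (√(2 * π) : ℝ) =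
      2 * Complex.exp (I * (t * (Real.log (2 * π) : ℝ))) := by
  have hpi : (0 : ℝ) < π := Real.pi_pos
  have h2 : (2 : ℂ) ^ (1 / 2 + I * t : ℂ) =
      Complex.exp ((Real.log 2 : ℝ) * (1 / 2 + I * t)) := by
    rw [Complex.cpow_def_of_ne_zero (by norm_num), Complex.ofReal_log (by norm_num)]
    norm_num
  have h3 : (π : ℂ) ^ (1 / 2 + I * t - 1 : ℂ) =
      Complex.exp ((Real.log π : ℝ) * (1 / 2 + I * t - 1)) := by
    rw [Complex.cpow_def_of_ne_zero (by exact_mod_cast hpi.ne'), Complex.ofReal_log hpi.le]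
  have h4 : ((√(2 * π) : ℝ) : ℂ) =
      Complex.exp (((Real.log 2 : ℝ) + (Real.log π : ℝ)) * (1 / 2)) := by
    rw [Real.sqrt_eq_rpow, Real.rpow_def_of_pos (by positivity), Complex.ofReal_exp,
      Real.log_mul (by norm_num) hpi.ne']
    push_cast
    rfl
  have h5 : Complex.exp ((Real.log 2 : ℝ)) = 2 := by
    rw [← Complex.ofReal_exp, Real.exp_log (by norm_num)]; norm_num
  rw [h2, h3, h4]
  conv_rhs => rw [← h5]
  rw [← Complex.exp_add, ← Complex.exp_add, ← Complex.exp_add,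
    Real.log_mul (by norm_num) hpi.ne']
  congr 1
  push_cast
  ring

lemma chi_half_add_eq {t : ℝ} (ht : 2 ≤ t) :
    ∃ R : ℂ, ‖R‖ ≤ 9 / t ∧ chi (1 / 2 + I * t) =
      Complex.exp (π / 4 * I) * Complex.exp (-(I * (phase (2 * π) t : ℝ))) *
        ((1 - I * ((Real.exp (-(π * t)) : ℝ) : ℂ)) * Complex.exp R) := by
  obtain ⟨R, hR, hG⟩ := Gamma_half_sub_mul_I ht
  refine ⟨R, hR, ?_⟩
  have hpi : (0 : ℝ) < π := Real.pi_pos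
  rw [chi, sin_pi_mul_half_add, show (1 - (1 / 2 + I * t) : ℂ) = 1 / 2 - I * t by ring, hG, phase,
    Real.log_div (by linarith) (by positivity)]
  have h := two_cpow_mul_pi_cpow t
  set q := (1 - I * ((Real.exp (-(π * t)) : ℝ) : ℂ))
  set A := (2 : ℂ) ^ (1 / 2 + I * t : ℂ) * (π : ℂ) ^ (1 / 2 + I * t - 1 : ℂ)
  set p := Complex.exp (π / 4 * I)
  set X := Complex.exp ((π * t / 2 : ℝ) : ℂ) with hX
  rw [show ∀ r E : ℂ, A * (1 / 2 * p * X * q) * (r * E) = (A * r) * (1 / 2 * p * q) * (X * E) by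
    intros; ring, h, hX, ← Complex.exp_add]
  rw [show ∀ E F : ℂ, 2 * E * (1 / 2 * p * q) * F = p * q * (E * F) by intros; ring,
    ← Complex.exp_add]
  rw [show ∀ E F : ℂ, p * E * (q * F) = p * q * (E * F) by intros; ring, ← Complex.exp_add]
  congr 2
  push_cast
  ring

lemma norm_one_sub_I_mul_exp {t : ℝ} (ht : 2 ≤ t) :
    1 / 2 ≤ ‖1 - I * ((Real.exp (-(π * t)) : ℝ) : ℂ)‖ ∧
      ‖(1 : ℂ) - (1 - I * ((Real.exp (-(π * t)) : ℝ) : ℂ))‖ ≤ 1 / t := by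
  have h1 : Real.exp (-(π * t)) ≤ 1 / t := by
    rw [Real.exp_neg, ← one_div]
    apply one_div_le_one_div_of_le (by linarith)
    nlinarith [Real.add_one_le_exp (π * t), Real.pi_gt_three]
  have h2 : ‖I * ((Real.exp (-(π * t)) : ℝ) : ℂ)‖ = Real.exp (-(π * t)) := by
    rw [norm_mul, Complex.norm_I, one_mul, Complex.norm_real,
      Real.norm_of_nonneg (Real.exp_pos _).le]
  constructor
  · have := norm_sub_norm_le (1 : ℂ) (I * ((Real.exp (-(π * t)) : ℝ) : ℂ))
    rw [h2, norm_one] at this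
    have h3 : 1 / t ≤ 1 / 2 := one_div_le_one_div_of_le (by norm_num) ht
    linarith
  · rw [sub_sub_cancel, h2]
    exact h1

lemma chi_half_add_ne_zero {t : ℝ} (ht : 2 ≤ t) : chi (1 / 2 + I * t) ≠ 0 := by
  obtain ⟨R, -, h⟩ := chi_half_add_eq ht
  have hq : (1 - I * ((Real.exp (-(π * t)) : ℝ) : ℂ)) ≠ 0 := by
    intro h0
    have := (norm_one_sub_I_mul_exp ht).1
    rw [h0, norm_zero] at this
    linarith
  rw [h]
  exact mul_ne_zero (mul_ne_zero (Complex.exp_ne_zero _) (Complex.exp_ne_zero _))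
    (mul_ne_zero hq (Complex.exp_ne_zero _))

lemma norm_inv_chi_sub_le {t : ℝ} (ht : 9 ≤ t) :
    ‖(chi (1 / 2 + I * t))⁻¹ -
      Complex.exp (-(π / 4 * I)) * Complex.exp (I * (phase (2 * π) t : ℝ))‖ ≤ 38 / t := by
  obtain ⟨R, hR, h⟩ := chi_half_add_eq (t := t) (by linarith)
  obtain ⟨hq, hq1⟩ := norm_one_sub_I_mul_exp (t := t) (by linarith)
  have ht0 : 0 < t := by linarith
  set q := (1 - I * ((Real.exp (-(π * t)) : ℝ) : ℂ))
  have hq0 : q ≠ 0 := norm_pos_iff.mp (by linarith)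
  have hR1 : ‖-R‖ ≤ 1 := by
    rw [norm_neg]
    refine hR.trans ((div_le_one ht0).mpr ht)
  have hE := Complex.norm_exp_sub_one_le hR1
  rw [norm_neg] at hE
  have hfac : (chi (1 / 2 + I * t))⁻¹ -
      Complex.exp (-(π / 4 * I)) * Complex.exp (I * (phase (2 * π) t : ℝ)) =
      Complex.exp (-(π / 4 * I)) * Complex.exp (I * (phase (2 * π) t : ℝ)) *
        ((Complex.exp (-R) - 1 + (1 - q)) / q) := by
    rw [h, mul_inv, mul_inv, mul_inv, ← Complex.exp_neg, ← Complex.exp_neg, ← Complex.exp_neg,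
      neg_neg]
    field_simp
    ring
  have hn1 : ‖Complex.exp (-(π / 4 * I))‖ = 1 := by
    rw [show (-(π / 4 * I) : ℂ) = ((-(π / 4) : ℝ) : ℂ) * I by push_cast; ring,
      Complex.norm_exp_ofReal_mul_I]
  have hn2 : ‖Complex.exp (I * (phase (2 * π) t : ℝ))‖ = 1 := by
    rw [mul_comm, Complex.norm_exp_ofReal_mul_I]
  rw [hfac, norm_mul, norm_mul, hn1, hn2, one_mul, one_mul, norm_div, div_le_iff₀ (by linarith)]
  have h19 : ‖Complex.exp (-R) - 1 + (1 - q)‖ ≤ 19 / t := by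
    refine (norm_add_le _ _).trans ?_
    calc _ ≤ 2 * (9 / t) + 1 / t := by gcongr; linarith
      _ = 19 / t := by ring
  refine h19.trans ?_
  have h0 : 0 ≤ 38 / t := by positivity
  calc 19 / t = 38 / t * (1 / 2) := by ring
    _ ≤ 38 / t * ‖q‖ := by gcongr

lemma continuousOn_inv_chi :
    ContinuousOn (fun t : ℝ => (chi (1 / 2 + I * t))⁻¹) (Set.Ici 2) := by
  intro t ht
  refine ContinuousAt.continuousWithinAt ?_
  refine ContinuousAt.inv₀ ?_ (chi_half_add_ne_zero ht)
  have hΓ : ContinuousAt Complex.Gamma (1 - (1 / 2 + I * t)) := by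
    refine (Complex.differentiableAt_Gamma _ fun m h => ?_).continuousAt
    have := congrArg Complex.re h
    simp at this
    have : (0 : ℝ) ≤ m := m.cast_nonneg
    linarith
  have hpi : (π : ℂ) ≠ 0 := by exact_mod_cast Real.pi_ne_zero
  have hs : ContinuousAt (fun t : ℝ => (1 / 2 + I * t : ℂ)) t := by fun_prop
  refine ContinuousAt.mul (ContinuousAt.mul (ContinuousAt.mul ?_ ?_) ?_) ?_
  · exact hs.const_cpow (Or.inl two_ne_zero)
  · exact (hs.sub continuousAt_const).const_cpow (Or.inl hpi)
  · fun_prop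
  · exact ContinuousAt.comp (f := fun t : ℝ => (1 - (1 / 2 + I * t) : ℂ)) hΓ (by fun_prop)

/-- Integration by parts against an oscillating exponential. -/
lemma norm_integral_mul_deriv_exp_le {a b : ℝ} (hab : a ≤ b) {g g' ψ ψ' : ℝ → ℂ}
    (hg : ∀ x ∈ Set.Icc a b, HasDerivAt g (g' x) x)
    (hψ : ∀ x ∈ Set.Icc a b, HasDerivAt ψ (ψ' x) x)
    (hg' : ContinuousOn g' (Set.Icc a b)) (hψ' : ContinuousOn ψ' (Set.Icc a b))
    (hre : ∀ x ∈ Set.Icc a b, (ψ x).re ≤ 0) :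
    ‖∫ x in a..b, g x * (ψ' x * Complex.exp (ψ x))‖ ≤
      ‖g a‖ + ‖g b‖ + ∫ x in a..b, ‖g' x‖ := by
  have hnorm : ∀ x ∈ Set.Icc a b, ‖Complex.exp (ψ x)‖ ≤ 1 := fun x hx => by
    rw [Complex.norm_exp]; exact Real.exp_le_one_iff.mpr (hre x hx)
  have hψc : ContinuousOn ψ (Set.Icc a b) := fun x hx => (hψ x hx).continuousAt.continuousWithinAt
  rw [← Set.uIcc_of_le hab] at hg hψ hg' hψ' hψc
  have hv : ∀ x ∈ Set.uIcc a b,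
      HasDerivAt (fun x => Complex.exp (ψ x)) (ψ' x * Complex.exp (ψ x)) x := fun x hx => by
    rw [mul_comm]; exact (hψ x hx).cexp
  rw [intervalIntegral.integral_mul_deriv_eq_deriv_mul hg hv hg'.intervalIntegrable
    (hψ'.mul (Complex.continuous_exp.comp_continuousOn hψc)).intervalIntegrable]
  have h1 : ‖g b * Complex.exp (ψ b)‖ ≤ ‖g b‖ := by
    rw [norm_mul]
    exact mul_le_of_le_one_right (norm_nonneg _) (hnorm b (Set.right_mem_Icc.mpr hab))
  have h2 : ‖g a * Complex.exp (ψ a)‖ ≤ ‖g a‖ := by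
    rw [norm_mul]
    exact mul_le_of_le_one_right (norm_nonneg _) (hnorm a (Set.left_mem_Icc.mpr hab))
  have h3 : ‖∫ x in a..b, g' x * Complex.exp (ψ x)‖ ≤ ∫ x in a..b, ‖g' x‖ := by
    refine intervalIntegral.norm_integral_le_of_norm_le hab ?_ hg'.norm.intervalIntegrable
    refine Filter.Eventually.of_forall fun x hx => ?_
    rw [norm_mul]
    exact mul_le_of_le_one_right (norm_nonneg _) (hnorm x (Set.Ioc_subset_Icc_self hx))
  refine (norm_sub_le _ _).trans ?_
  have := norm_sub_le (g b * Complex.exp (ψ b)) (g a * Complex.exp (ψ a))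
  linarith

lemma norm_integral_gaussian_tail_le {b : ℂ} (hb : 0 < b.re) {Y M : ℝ} (hY : 0 < Y) (hM : Y ≤ M) :
    ‖∫ x in Y..M, Complex.exp (-b * (x : ℂ) ^ 2)‖ ≤ 1 / (‖b‖ * Y) := by
  have hb0 : b ≠ 0 := by rintro rfl; simp at hb
  have hbn : 0 < ‖b‖ := norm_pos_iff.mpr hb0
  have hpos : ∀ x ∈ Set.Icc Y M, 0 < x := fun x hx => hY.trans_le hx.1
  have hne : ∀ x ∈ Set.Icc Y M, (x : ℂ) ≠ 0 := fun x hx => by exact_mod_cast (hpos x hx).ne'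
  have hd : ∀ x : ℝ, HasDerivAt (fun x : ℝ => (x : ℂ)) 1 x := fun x => Complex.ofRealCLM.hasDerivAt
  have h := norm_integral_mul_deriv_exp_le hM (g := fun x : ℝ => -(1 / (2 * b)) * (x : ℂ)⁻¹)
    (g' := fun x : ℝ => -(1 / (2 * b)) * (-1 / (x : ℂ) ^ 2)) (ψ := fun x : ℝ => -b * (x : ℂ) ^ 2)
    (ψ' := fun x : ℝ => -b * (2 * x)) ?_ ?_ ?_ ?_ ?_
  · have e1 : ∫ x in Y..M, Complex.exp (-b * (x : ℂ) ^ 2) = ∫ x in Y..M,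
        -(1 / (2 * b)) * (x : ℂ)⁻¹ * (-b * (2 * x) * Complex.exp (-b * (x : ℂ) ^ 2)) := by
      refine intervalIntegral.integral_congr fun x hx => ?_
      rw [Set.uIcc_of_le hM] at hx
      have := hne x hx
      field_simp
    rw [e1]
    refine h.trans (le_of_eq ?_)
    have e2 : ∫ x in Y..M, ‖-(1 / (2 * b)) * (-1 / (x : ℂ) ^ 2)‖ =
        1 / (2 * ‖b‖) * (Y⁻¹ - M⁻¹) := by
      have e3 : ∀ x : ℝ, ‖-(1 / (2 * b)) * (-1 / (x : ℂ) ^ 2)‖ =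
          1 / (2 * ‖b‖) * x ^ (-2 : ℤ) := by
        intro x
        rw [norm_mul, norm_neg, norm_div, norm_div, norm_neg, norm_mul, norm_pow, Complex.norm_real]
        simp [zpow_neg]
      simp_rw [e3]
      rw [intervalIntegral.integral_const_mul, integral_zpow]
      · congr 1
        norm_num
        ring
      · right
        refine ⟨by norm_num, ?_⟩
        rw [Set.uIcc_of_le hM]
        exact fun h => absurd h.1 (not_le.mpr hY)
    have hM0 : 0 < M := hY.trans_le hM
    rw [e2]
    simp only [norm_mul, norm_neg, norm_div, norm_one, norm_inv, Complex.norm_real,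
      Real.norm_of_nonneg hY.le, Real.norm_of_nonneg hM0.le, Complex.norm_ofNat]
    field_simp
    ring
  · intro x hx
    exact ((hasDerivAt_inv (hne x hx)).comp x (hd x) |>.congr_deriv (by ring)).const_mul _
  · intro x hx
    exact (((hd x).pow 2).const_mul (-b)).congr_deriv (by simp)
  · refine continuousOn_const.mul (continuousOn_const.div (by fun_prop) fun x hx => ?_)
    exact pow_ne_zero 2 (hne x hx)
  · fun_prop
  · intro x hx
    have : (-b * (x : ℂ) ^ 2).re = -(b.re * x ^ 2) := by
      rw [← Complex.ofReal_pow, Complex.re_mul_ofReal]; simp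
    rw [this]
    have : 0 ≤ b.re * x ^ 2 := by positivity
    linarith

lemma norm_integral_gaussian_sub_le {b : ℂ} (hb : 0 < b.re) {Y : ℝ} (hY : 0 < Y) :
    ‖(∫ x in (0 : ℝ)..Y, Complex.exp (-b * (x : ℂ) ^ 2)) - (π / b) ^ (1 / 2 : ℂ) / 2‖ ≤
      1 / (‖b‖ * Y) := by
  have hint := (integrable_cexp_neg_mul_sq hb).integrableOn (s := Set.Ioi 0)
  have hlim := intervalIntegral_tendsto_integral_Ioi 0 hint tendsto_id
  rw [integral_gaussian_complex_Ioi hb] at hlim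
  have hlim2 := (tendsto_const_nhds
    (x := ∫ x in (0 : ℝ)..Y, Complex.exp (-b * (x : ℂ) ^ 2))).sub hlim
  refine le_of_tendsto hlim2.norm ?_
  filter_upwards [eventually_ge_atTop Y] with M hM
  have hI : ∀ u v : ℝ,
      IntervalIntegrable (fun x : ℝ => Complex.exp (-b * (x : ℂ) ^ 2)) volume u v :=
    fun u v => Continuous.intervalIntegrable (by fun_prop) _ _
  rw [id, intervalIntegral.integral_interval_sub_left (hI _ _) (hI _ _),
    intervalIntegral.integral_symm, norm_neg]
  exact norm_integral_gaussian_tail_le hb hY hM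

/-- Half of the Fresnel integral `∫ exp (i λ x ^ 2 / 2)` over the real line. -/
noncomputable def halfFresnel (l : ℝ) : ℂ := (√(2 * π / l) / 2 : ℝ) * Complex.exp (π / 4 * I)

lemma norm_integral_fresnel_sub_le {l Y : ℝ} (hl : 0 < l) (hY : 0 < Y) :
    ‖(∫ x in (0 : ℝ)..Y, Complex.exp (I * (l * (x ^ 2 / 2) : ℝ))) - halfFresnel l‖ ≤
      2 / (l * Y) := by
  set b : ℝ → ℂ := fun η => η - l / 2 * I with hbdef
  have hbc : Continuous b := by fun_prop
  have hbre : ∀ η, (b η).re = η := fun η => by simp [hbdef]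
  have hb0 : b 0 ≠ 0 := by simp [hbdef, hl.ne']
  have hbn : ‖b 0‖ = l / 2 := by simp [hbdef, abs_of_pos hl]
  have hquot : (π : ℂ) / b 0 = ((2 * π / l : ℝ) : ℂ) * I := by
    have : (l : ℂ) ≠ 0 := by exact_mod_cast hl.ne'
    simp only [hbdef]
    push_cast
    rw [div_eq_iff (by simpa [hbdef] using hb0)]
    field_simp
    ring_nf
    simp
  have hslit : (π : ℂ) / b 0 ∈ Complex.slitPlane := by
    rw [hquot]
    refine Or.inr ?_
    simp only [Complex.im_ofReal_mul, Complex.I_im, mul_one]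
    positivity
  have hpow : ((π : ℂ) / b 0) ^ (1 / 2 : ℂ) / 2 = halfFresnel l := by
    have hp : 0 < 2 * π / l := by positivity
    have hpI : ((2 * π / l : ℝ) : ℂ) * I ≠ 0 :=
      mul_ne_zero (by exact_mod_cast hp.ne') I_ne_zero
    rw [hquot, Complex.cpow_def_of_ne_zero hpI, Complex.log_ofReal_mul hp I_ne_zero,
      Complex.log_I, halfFresnel, Real.sqrt_eq_rpow, Real.rpow_def_of_pos hp, add_mul,
      Complex.exp_add]
    push_cast
    ring_nf
  have hint : Continuous fun η : ℝ => ∫ x in (0 : ℝ)..Y, Complex.exp (-b η * (x : ℂ) ^ 2) := by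
    apply intervalIntegral.continuous_parametric_intervalIntegral_of_continuous
    · simp only [Function.uncurry_def]
      fun_prop
    · fun_prop
  have hlhs : Tendsto (fun η : ℝ => ‖(∫ x in (0 : ℝ)..Y, Complex.exp (-b η * (x : ℂ) ^ 2)) -
      ((π : ℂ) / b η) ^ (1 / 2 : ℂ) / 2‖) (nhdsWithin 0 (Set.Ioi 0))
      (nhds ‖(∫ x in (0 : ℝ)..Y, Complex.exp (-b 0 * (x : ℂ) ^ 2)) -
      ((π : ℂ) / b 0) ^ (1 / 2 : ℂ) / 2‖) := by
    refine Tendsto.mono_left ?_ nhdsWithin_le_nhds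
    refine ((hint.tendsto 0).sub (Tendsto.div_const ?_ 2)).norm
    have h1 : Tendsto (fun η => (π : ℂ) / b η) (nhds 0) (nhds ((π : ℂ) / b 0)) :=
      tendsto_const_nhds.div (hbc.tendsto 0) hb0
    exact h1.cpow tendsto_const_nhds hslit
  have hrhs : Tendsto (fun η : ℝ => 1 / (‖b η‖ * Y)) (nhdsWithin 0 (Set.Ioi 0))
      (nhds (1 / (‖b 0‖ * Y))) := by
    refine Tendsto.mono_left ?_ nhdsWithin_le_nhds
    exact tendsto_const_nhds.div ((hbc.tendsto 0).norm.mul_const Y)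
      (mul_ne_zero (norm_ne_zero_iff.mpr hb0) hY.ne')
  have h := le_of_tendsto_of_tendsto hlhs hrhs <| by
    filter_upwards [self_mem_nhdsWithin] with η hη
    exact norm_integral_gaussian_sub_le (by rw [hbre]; exact hη) hY
  rw [hpow, hbn] at h
  refine (le_of_eq ?_).trans (h.trans (le_of_eq (by field_simp)))
  congr 2
  refine intervalIntegral.integral_congr fun x _ => ?_
  simp only [hbdef]
  push_cast
  ring_nf

lemma nonneg_of_hasDerivAt_nonneg {U : ℝ} {f f' : ℝ → ℝ}
    (hf : ∀ u ∈ Set.Icc 0 U, HasDerivAt f (f' u) u) (h0 : f 0 = 0)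
    (hf' : ∀ u ∈ Set.Icc 0 U, 0 ≤ f' u) : ∀ u ∈ Set.Icc 0 U, 0 ≤ f u := by
  intro u hu
  have hmono : MonotoneOn f (Set.Icc 0 U) := by
    refine monotoneOn_of_deriv_nonneg (convex_Icc 0 U)
      (fun x hx => (hf x hx).continuousAt.continuousWithinAt) ?_ ?_
    · intro x hx
      exact (hf x (interior_subset hx)).differentiableAt.differentiableWithinAt
    · intro x hx
      rw [(hf x (interior_subset hx)).deriv]
      exact hf' x (interior_subset hx)
  rw [← h0]
  exact hmono ⟨le_rfl, hu.1.trans hu.2⟩ hu hu.1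

/-- The bounds for a phase `h` with a nondegenerate critical point at the origin that are used
in the method of stationary phase. -/
lemma bounds_of_nondegenerate_critical_point {U : ℝ} {h d m : ℝ → ℝ}
    (hh : ∀ u ∈ Set.Icc 0 U, HasDerivAt h (d u) u)
    (hd : ∀ u ∈ Set.Icc 0 U, HasDerivAt d (m u) u)
    (h0 : h 0 = 0) (d0 : d 0 = 0)
    (hm : ∀ u ∈ Set.Icc 0 U, 1 / 4 ≤ m u ∧ m u ≤ 4 ∧ |m u - 1| ≤ 4 * u) :
    ∀ u ∈ Set.Icc 0 U, u / 4 ≤ d u ∧ d u ≤ 4 * u ∧ |d u - u| ≤ 2 * u ^ 2 ∧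
      u ^ 2 / 8 ≤ h u ∧ h u ≤ 2 * u ^ 2 ∧ |2 * h u - u ^ 2| ≤ 2 * u ^ 3 := by
  have hid : ∀ u : ℝ, HasDerivAt (fun u : ℝ => u) 1 u := hasDerivAt_id'
  have hsq : ∀ u : ℝ, HasDerivAt (fun u : ℝ => u ^ 2) (2 * u) u := fun u => by
    simpa using hasDerivAt_pow 2 u
  have hcu : ∀ u : ℝ, HasDerivAt (fun u : ℝ => u ^ 3) (3 * u ^ 2) u := fun u => by
    simpa using hasDerivAt_pow 3 u
  have a1 := nonneg_of_hasDerivAt_nonneg (f := fun u => d u - 1 / 4 * u)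
    (fun u hu => (hd u hu).sub ((hid u).const_mul _)) (by simp [d0])
    (fun u hu => by linarith [(hm u hu).1])
  have a2 := nonneg_of_hasDerivAt_nonneg (f := fun u => 4 * u - d u)
    (fun u hu => ((hid u).const_mul _).sub (hd u hu)) (by simp [d0])
    (fun u hu => by linarith [(hm u hu).2.1])
  have a3 := nonneg_of_hasDerivAt_nonneg (f := fun u => 2 * u ^ 2 - (d u - u))
    (fun u hu => ((hsq u).const_mul _).sub ((hd u hu).sub (hid u))) (by simp [d0])
    (fun u hu => by linarith [(abs_le.mp (hm u hu).2.2).2])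
  have a4 := nonneg_of_hasDerivAt_nonneg (f := fun u => 2 * u ^ 2 + (d u - u))
    (fun u hu => ((hsq u).const_mul _).add ((hd u hu).sub (hid u))) (by simp [d0])
    (fun u hu => by linarith [(abs_le.mp (hm u hu).2.2).1])
  have b1 := nonneg_of_hasDerivAt_nonneg (f := fun u => h u - 1 / 8 * u ^ 2)
    (fun u hu => (hh u hu).sub ((hsq u).const_mul _)) (by simp [h0])
    (fun u hu => by linarith [a1 u hu])
  have b2 := nonneg_of_hasDerivAt_nonneg (f := fun u => 2 * u ^ 2 - h u)
    (fun u hu => ((hsq u).const_mul _).sub (hh u hu)) (by simp [h0])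
    (fun u hu => by linarith [a2 u hu])
  have b3 := nonneg_of_hasDerivAt_nonneg (f := fun u => 2 * u ^ 3 - (2 * h u - u ^ 2))
    (fun u hu => ((hcu u).const_mul _).sub (((hh u hu).const_mul _).sub (hsq u))) (by simp [h0])
    (fun u hu => by nlinarith [a3 u hu, sq_nonneg u])
  have b4 := nonneg_of_hasDerivAt_nonneg (f := fun u => 2 * u ^ 3 + (2 * h u - u ^ 2))
    (fun u hu => ((hcu u).const_mul _).add (((hh u hu).const_mul _).sub (hsq u))) (by simp [h0])
    (fun u hu => by nlinarith [a4 u hu, sq_nonneg u])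
  intro u hu
  have := a1 u hu; have := a2 u hu; have := a3 u hu; have := a4 u hu
  have := b1 u hu; have := b2 u hu; have := b3 u hu; have := b4 u hu
  refine ⟨by linarith, by linarith, abs_le.mpr ⟨by linarith, by linarith⟩, by linarith,
    by linarith, abs_le.mpr ⟨by linarith, by linarith⟩⟩

lemma abs_inv_sub_inv_le {u d y m : ℝ} (hu : 0 < u) (hd : u / 4 ≤ d) (hd4 : d ≤ 4 * u)
    (hdu : |d - u| ≤ 2 * u ^ 2) (hy : u / 2 ≤ y) (hy2 : y ≤ 2 * u)
    (hyu : |y ^ 2 - u ^ 2| ≤ 2 * u ^ 3) (hm : |m - 1| ≤ 4 * u) :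
    |1 / d - 1 / y| ≤ 128 ∧ |d / y ^ 3 - m / d ^ 2| ≤ 61440 / u := by
  have hd0 : 0 < d := by linarith
  have hy0 : 0 < y := by linarith
  have h1 : |d ^ 2 - u ^ 2| ≤ 10 * u ^ 3 := by
    rw [show d ^ 2 - u ^ 2 = (d - u) * (d + u) by ring, abs_mul,
      abs_of_pos (a := d + u) (by linarith)]
    calc _ ≤ 2 * u ^ 2 * (5 * u) := by gcongr; linarith
      _ = _ := by ring
  have h2 : |y ^ 2 - d ^ 2| ≤ 12 * u ^ 3 := by
    rw [abs_le] at *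
    constructor <;> linarith [h1.1, h1.2, hyu.1, hyu.2]
  have h3 : |y - d| ≤ 16 * u ^ 2 := by
    have : |y - d| * (y + d) ≤ 12 * u ^ 3 := by
      rw [← abs_of_pos (a := y + d) (by linarith), ← abs_mul]
      rwa [show (y - d) * (y + d) = y ^ 2 - d ^ 2 by ring]
    have h4 : |y - d| * (3 / 4 * u) ≤ |y - d| * (y + d) := by gcongr; linarith
    have h5 : |y - d| * (3 / 4 * u) ≤ 16 * u ^ 2 * (3 / 4 * u) := by nlinarith
    exact le_of_mul_le_mul_right h5 (by positivity)
  constructor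
  · rw [div_sub_div _ _ hd0.ne' hy0.ne', abs_div, abs_of_pos (a := d * y) (by positivity),
      div_le_iff₀ (by positivity), one_mul, mul_one]
    calc _ ≤ 16 * u ^ 2 := h3
      _ = 128 * (u / 4 * (u / 2)) := by ring
      _ ≤ _ := by gcongr
  · rw [div_sub_div _ _ (by positivity) (by positivity), abs_div,
      abs_of_pos (a := y ^ 3 * d ^ 2) (by positivity), div_le_div_iff₀ (by positivity) hu]
    have h6 : |d * d ^ 2 - y ^ 3 * m| ≤ 480 * u ^ 4 := by
      rw [show d * d ^ 2 - y ^ 3 * m =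
          -((y - d) * (d ^ 2 + d * y + y ^ 2) + (m - 1) * y ^ 3) by ring,
        abs_neg]
      refine (abs_add_le _ _).trans ?_
      rw [abs_mul, abs_mul, abs_of_pos (a := d ^ 2 + d * y + y ^ 2) (by positivity),
        abs_of_pos (a := y ^ 3) (by positivity)]
      calc _ ≤ 16 * u ^ 2 * ((4 * u) ^ 2 + (4 * u) * (2 * u) + (2 * u) ^ 2)
            + 4 * u * (2 * u) ^ 3 := by gcongr
        _ = _ := by ring
    calc _ ≤ 480 * u ^ 4 * u := by gcongr
      _ = 61440 * ((u / 2) ^ 3 * (u / 4) ^ 2) := by ring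
      _ ≤ _ := by gcongr

lemma norm_exp_I_mul (x : ℝ) : ‖Complex.exp (I * (x : ℂ))‖ = 1 := by
  rw [mul_comm, Complex.norm_exp_ofReal_mul_I]

lemma norm_halfFresnel_le {l : ℝ} (hl : 0 < l) : ‖halfFresnel l‖ ≤ 2 / √l := by
  have h1 : ‖Complex.exp (π / 4 * I)‖ = 1 := by
    rw [show (π / 4 * I : ℂ) = ((π / 4 : ℝ) : ℂ) * I by push_cast; ring,
      Complex.norm_exp_ofReal_mul_I]
  rw [halfFresnel, norm_mul, h1, mul_one, Complex.norm_real, Real.norm_of_nonneg (by positivity),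
    Real.sqrt_div (by positivity)]
  have : √(2 * π) ≤ 4 := by
    rw [Real.sqrt_le_left (by norm_num)]
    linarith [Real.pi_lt_four]
  have h0 : 0 < √l := Real.sqrt_pos.mpr hl
  rw [div_div, div_le_div_iff₀ (by positivity) h0]
  nlinarith

/-- The method of stationary phase for one half of a neighbourhood of the critical point. -/
lemma norm_integral_exp_sub_halfFresnel_le {U l : ℝ} (hU : 0 < U) (hU3 : U ≤ 3) (hl : 1 ≤ l)
    {h d m : ℝ → ℝ} (hh : ∀ u ∈ Set.Icc 0 U, HasDerivAt h (d u) u)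
    (hd : ∀ u ∈ Set.Icc 0 U, HasDerivAt d (m u) u) (hmc : ContinuousOn m (Set.Icc 0 U))
    (h0 : h 0 = 0) (d0 : d 0 = 0)
    (hm : ∀ u ∈ Set.Icc 0 U, 1 / 4 ≤ m u ∧ m u ≤ 4 ∧ |m u - 1| ≤ 4 * u) :
    ‖(∫ u in (0 : ℝ)..U, Complex.exp (I * (l * h u : ℝ))) - halfFresnel l‖ ≤
      130000 * ((1 + Real.log l) / l + 1 / (l * U)) := by
  have hl0 : 0 < l := by linarith
  have hlog : 0 ≤ Real.log l := Real.log_nonneg hl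
  have hq0 : 0 ≤ (1 + Real.log l) / l := by positivity
  have hhc : ContinuousOn h (Set.Icc 0 U) := fun u hu => (hh u hu).continuousAt.continuousWithinAt
  have hdc : ContinuousOn d (Set.Icc 0 U) := fun u hu => (hd u hu).continuousAt.continuousWithinAt
  have hEc : ContinuousOn (fun u => Complex.exp (I * (l * h u : ℝ))) (Set.Icc 0 U) := by
    refine Complex.continuous_exp.comp_continuousOn (continuousOn_const.mul ?_)
    exact Complex.continuous_ofReal.comp_continuousOn (continuousOn_const.mul hhc)
  have triv : ∀ a b : ℝ, a ≤ b → ∀ f : ℝ → ℝ,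
      ‖∫ u in a..b, Complex.exp (I * (f u : ℝ))‖ ≤ b - a := fun a b hab f => by
    have := intervalIntegral.norm_integral_le_of_norm_le_const (a := a) (b := b) (C := 1)
      (f := fun u => Complex.exp (I * (f u : ℝ))) (fun u _ => (norm_exp_I_mul _).le)
    rwa [one_mul, abs_of_nonneg (by linarith)] at this
  rcases le_or_gt U (1 / l) with hUl | hUl
  · have h1 : 1 ≤ 1 / (l * U) := by
      rw [le_div_iff₀ hl0] at hUl
      rw [le_div_iff₀ (by positivity)]
      linarith
    have h2 := triv 0 U hU.le (fun u => l * h u)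
    have h3 := norm_halfFresnel_le hl0
    have h4 : 2 / √l ≤ 2 := div_le_self (by norm_num) (Real.one_le_sqrt.mpr hl)
    refine (norm_sub_le _ _).trans ?_
    linarith
  set ε := 1 / l with hε
  have hε0 : 0 < ε := by positivity
  have hsub : Set.Icc ε U ⊆ Set.Icc 0 U := Set.Icc_subset_Icc_left hε0.le
  have hbd := bounds_of_nondegenerate_critical_point hh hd h0 d0 hm
  set y : ℝ → ℝ := fun u => √(2 * h u) with hy
  have hyb : ∀ u ∈ Set.Icc 0 U, u / 2 ≤ y u ∧ y u ≤ 2 * u ∧ y u ^ 2 = 2 * h u := by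
    intro u hu
    obtain ⟨-, -, -, b1, b2, -⟩ := hbd u hu
    refine ⟨?_, ?_, ?_⟩
    · exact Real.le_sqrt_of_sq_le (by nlinarith)
    · exact Real.sqrt_le_iff.mpr ⟨by linarith [hu.1], by nlinarith⟩
    · exact Real.sq_sqrt (by nlinarith [sq_nonneg u])
  have hypos : ∀ u ∈ Set.Icc ε U, 0 < y u := fun u hu => by
    linarith [(hyb u (hsub hu)).1, hu.1]
  have hdpos : ∀ u ∈ Set.Icc ε U, 0 < d u := fun u hu => by
    linarith [(hbd u (hsub hu)).1, hu.1]
  have hyd : ∀ u ∈ Set.Icc ε U, HasDerivAt y (d u / y u) u := fun u hu => by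
    have hne : 2 * h u ≠ 0 := by
      rw [← (hyb u (hsub hu)).2.2]; exact pow_ne_zero 2 (hypos u hu).ne'
    refine (((hh u (hsub hu)).const_mul 2).sqrt hne).congr_deriv ?_
    have := (hypos u hu).ne'
    simp only [hy] at this ⊢
    field_simp
  have hyc : ContinuousOn y (Set.Icc ε U) := fun u hu => (hyd u hu).continuousAt.continuousWithinAt
  have hkey : ∀ u ∈ Set.Icc ε U, |1 / d u - 1 / y u| ≤ 128 ∧
      |d u / y u ^ 3 - m u / d u ^ 2| ≤ 61440 / u := fun u hu => by
    obtain ⟨b1, b2, b3, -, -, b4⟩ := hbd u (hsub hu)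
    obtain ⟨c1, c2, c3⟩ := hyb u (hsub hu)
    exact abs_inv_sub_inv_le (hε0.trans_le hu.1) b1 b2 b3 c1 c2 (by rwa [c3]) (hm u (hsub hu)).2.2
  set E : ℝ → ℂ := fun u => Complex.exp (I * (l * h u : ℝ)) with hE
  have hsplit : ∫ u in (0 : ℝ)..U, E u = (∫ u in (0 : ℝ)..ε, E u) +
      ((∫ u in ε..U, (d u / y u) • E u) +
      ∫ u in ε..U, (((1 / d u - 1 / y u) / l : ℝ) * (-I)) * (I * (l * d u : ℝ) * E u)) := by
    rw [← intervalIntegral.integral_add, ← intervalIntegral.integral_add_adjacent_intervals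
      (b := ε)]
    · congr 1
      refine intervalIntegral.integral_congr fun u hu => ?_
      rw [Set.uIcc_of_le hUl.le] at hu
      have e1 : (d u : ℂ) ≠ 0 := by exact_mod_cast (hdpos u hu).ne'
      have e2 : (y u : ℂ) ≠ 0 := by exact_mod_cast (hypos u hu).ne'
      have e3 : (l : ℂ) ≠ 0 := by exact_mod_cast hl0.ne'
      simp only [Complex.real_smul]
      push_cast
      field_simp
      ring_nf
      simp
    · refine ContinuousOn.intervalIntegrable ?_
      rw [Set.uIcc_of_le hε0.le]
      exact hEc.mono (Set.Icc_subset_Icc_right hUl.le)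
    · refine ContinuousOn.intervalIntegrable ?_
      rw [Set.uIcc_of_le hUl.le]
      exact hEc.mono hsub
    · refine ContinuousOn.intervalIntegrable ?_
      rw [Set.uIcc_of_le hUl.le]
      exact ((hdc.mono hsub).div hyc fun u hu => (hypos u hu).ne').smul (hEc.mono hsub)
    · refine ContinuousOn.intervalIntegrable ?_
      rw [Set.uIcc_of_le hUl.le]
      refine ContinuousOn.mul (ContinuousOn.mul ?_ continuousOn_const)
        (ContinuousOn.mul (continuousOn_const.mul ?_) (hEc.mono hsub))
      · refine Complex.continuous_ofReal.comp_continuousOn (ContinuousOn.div_const ?_ l)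
        exact (continuousOn_const.div (hdc.mono hsub) fun u hu => (hdpos u hu).ne').sub
          (continuousOn_const.div hyc fun u hu => (hypos u hu).ne')
      · exact Complex.continuous_ofReal.comp_continuousOn (continuousOn_const.mul (hdc.mono hsub))
  have hsubst : ∫ u in ε..U, (d u / y u) • E u =
      (∫ x in (0 : ℝ)..y U, Complex.exp (I * (l * (x ^ 2 / 2) : ℝ))) -
        ∫ x in (0 : ℝ)..y ε, Complex.exp (I * (l * (x ^ 2 / 2) : ℝ)) := by
    have hG : Continuous fun x : ℝ => Complex.exp (I * (l * (x ^ 2 / 2) : ℝ)) := by fun_prop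
    rw [intervalIntegral.integral_interval_sub_left (hG.intervalIntegrable _ _)
      (hG.intervalIntegrable _ _), ← intervalIntegral.integral_deriv_smul_comp (f := y)
      (f' := fun u => d u / y u) _ _ hG]
    · refine intervalIntegral.integral_congr fun u hu => ?_
      rw [Set.uIcc_of_le hUl.le] at hu
      simp only [Function.comp, (hyb u (hsub hu)).2.2, hE]
      congr 5
      ring
    · rw [Set.uIcc_of_le hUl.le]; exact hyd
    · rw [Set.uIcc_of_le hUl.le]
      exact (hdc.mono hsub).div hyc fun u hu => (hypos u hu).ne'
  have hεm : ε ∈ Set.Icc ε U := Set.left_mem_Icc.mpr hUl.le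
  have hUm : U ∈ Set.Icc ε U := Set.right_mem_Icc.mpr hUl.le
  have n1 : ‖∫ u in (0 : ℝ)..ε, E u‖ ≤ ε := by
    have := triv 0 ε hε0.le (fun u => l * h u)
    rwa [sub_zero] at this
  have n2 : ‖∫ x in (0 : ℝ)..y ε, Complex.exp (I * (l * (x ^ 2 / 2) : ℝ))‖ ≤ 2 * ε := by
    refine (triv 0 (y ε) (hypos ε hεm).le _).trans ?_
    rw [sub_zero]
    exact (hyb ε (hsub hεm)).2.1
  have n3 : ‖(∫ x in (0 : ℝ)..y U, Complex.exp (I * (l * (x ^ 2 / 2) : ℝ))) - halfFresnel l‖ ≤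
      4 * (1 / (l * U)) := by
    refine (norm_integral_fresnel_sub_le hl0 (hypos U hUm)).trans ?_
    have := (hyb U (hsub hUm)).1
    calc 2 / (l * y U) ≤ 2 / (l * (U / 2)) := by gcongr
      _ = _ := by field_simp; norm_num
  have n4 : ‖∫ u in ε..U, (((1 / d u - 1 / y u) / l : ℝ) * (-I)) * (I * (l * d u : ℝ) * E u)‖ ≤
      (256 + 61440 * (2 + Real.log l)) / l := by
    have hn : ∀ r : ℝ, ‖((r / l : ℝ) : ℂ) * (-I)‖ = |r| / l := fun r => by
      rw [norm_mul, norm_neg, Complex.norm_I, mul_one, Complex.norm_real, Real.norm_eq_abs,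
        abs_div, abs_of_pos hl0]
    have hibp := norm_integral_mul_deriv_exp_le hUl.le
      (g := fun u => ((1 / d u - 1 / y u) / l : ℝ) * (-I))
      (g' := fun u => ((d u / y u ^ 3 - m u / d u ^ 2) / l : ℝ) * (-I))
      (ψ := fun u => I * (l * h u : ℝ)) (ψ' := fun u => I * (l * d u : ℝ)) ?_ ?_ ?_ ?_ ?_
    · refine hibp.trans ?_
      simp only [hn]
      have i1 : ∫ u in ε..U, |d u / y u ^ 3 - m u / d u ^ 2| / l ≤
          61440 * (2 + Real.log l) / l := by
        have i2 : ∫ u in ε..U, |d u / y u ^ 3 - m u / d u ^ 2| / l ≤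
            ∫ u in ε..U, 61440 / l * u⁻¹ := by
          refine intervalIntegral.integral_mono_on hUl.le ?_ ?_ fun u hu => ?_
          · refine ContinuousOn.intervalIntegrable ?_
            rw [Set.uIcc_of_le hUl.le]
            refine ContinuousOn.div_const (ContinuousOn.abs ?_) l
            exact ((hdc.mono hsub).div (hyc.pow 3) fun u hu => pow_ne_zero 3 (hypos u hu).ne').sub
              ((hmc.mono hsub).div ((hdc.mono hsub).pow 2)
                fun u hu => pow_ne_zero 2 (hdpos u hu).ne')
          · refine ContinuousOn.intervalIntegrable ?_
            rw [Set.uIcc_of_le hUl.le]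
            exact continuousOn_const.mul
              (continuousOn_id.inv₀ fun u hu => (hε0.trans_le hu.1).ne')
          · have := (hkey u hu).2
            calc _ ≤ 61440 / u / l := by gcongr
              _ = _ := by ring
        refine i2.trans ?_
        rw [intervalIntegral.integral_const_mul, integral_inv_of_pos hε0 hU, div_mul_eq_mul_div]
        have : Real.log (U / ε) ≤ 2 + Real.log l := by
          rw [hε, div_div_eq_mul_div, div_one, Real.log_mul hU.ne' hl0.ne']
          have := Real.log_le_sub_one_of_pos hU
          linarith
        gcongr
      have j1 := (hkey ε hεm).1
      have j2 := (hkey U hUm).1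
      calc _ ≤ 128 / l + 128 / l + 61440 * (2 + Real.log l) / l := by gcongr
        _ = _ := by ring
    · intro u hu
      have hd' := (hd u (hsub hu)).inv (hdpos u hu).ne'
      have hy' := (hyd u hu).inv (hypos u hu).ne'
      have hr : HasDerivAt (fun u => (1 / d u - 1 / y u) / l)
          ((d u / y u ^ 3 - m u / d u ^ 2) / l) u := by
        simp only [one_div]
        refine ((hd'.sub hy').div_const l).congr_deriv ?_
        have e1 := (hdpos u hu).ne'
        have e2 := (hypos u hu).ne'
        field_simp
        ring
      exact hr.ofReal_comp.mul_const _
    · intro u hu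
      exact ((hh u (hsub hu)).const_mul l).ofReal_comp.const_mul I
    · refine ContinuousOn.mul ?_ continuousOn_const
      refine Complex.continuous_ofReal.comp_continuousOn (ContinuousOn.div_const ?_ l)
      exact ((hdc.mono hsub).div (hyc.pow 3) fun u hu => pow_ne_zero 3 (hypos u hu).ne').sub
        ((hmc.mono hsub).div ((hdc.mono hsub).pow 2) fun u hu => pow_ne_zero 2 (hdpos u hu).ne')
    · refine continuousOn_const.mul ?_
      exact Complex.continuous_ofReal.comp_continuousOn (continuousOn_const.mul (hdc.mono hsub))
    · intro u _
      simp
  rw [hsplit, hsubst]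
  set A := ∫ u in (0 : ℝ)..ε, E u
  set B := ∫ x in (0 : ℝ)..y U, Complex.exp (I * (l * (x ^ 2 / 2) : ℝ))
  set C := ∫ x in (0 : ℝ)..y ε, Complex.exp (I * (l * (x ^ 2 / 2) : ℝ))
  set D := ∫ u in ε..U, (((1 / d u - 1 / y u) / l : ℝ) * (-I)) * (I * (l * d u : ℝ) * E u)
  have htri : ‖A + (B - C + D) - halfFresnel l‖ ≤ ‖A‖ + ‖C‖ + ‖B - halfFresnel l‖ + ‖D‖ := by
    rw [show A + (B - C + D) - halfFresnel l = A - C + (B - halfFresnel l) + D by ring]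
    refine (norm_add_le _ _).trans ?_
    gcongr
    refine (norm_add_le _ _).trans ?_
    gcongr
    exact norm_sub_le _ _
  have hfin : ε + 2 * ε + (256 + 61440 * (2 + Real.log l)) / l ≤
      130000 * ((1 + Real.log l) / l) := by
    rw [hε, ← mul_div_assoc, ← mul_div_assoc, ← add_div, ← add_div]
    gcongr
    linarith
  have hpos : 0 ≤ 1 / (l * U) := by positivity
  linarith

lemma norm_integral_exp_entropy_sub_halfFresnel_le {κ σ U : ℝ} (hκ : 1 ≤ κ)
    (hσ : σ = 1 ∨ σ = -1) (hU : 0 < U) (h1 : 1 / 4 ≤ 1 + σ * U) (h4 : 1 + σ * U ≤ 4) :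
    ‖(∫ u in (0 : ℝ)..U,
        Complex.exp (I * (κ * ((1 + σ * u) * Real.log (1 + σ * u) - σ * u) : ℝ))) -
      halfFresnel κ‖ ≤ 130000 * ((1 + Real.log κ) / κ + 1 / (κ * U)) := by
  have hb : ∀ u ∈ Set.Icc 0 U, 1 / 4 ≤ 1 + σ * u ∧ 1 + σ * u ≤ 4 := fun u hu => by
    rcases hσ with rfl | rfl <;> constructor <;> linarith [hu.1, hu.2]
  have hσ2 : σ * σ = 1 := by rcases hσ with rfl | rfl <;> norm_num
  have haff : ∀ u, HasDerivAt (fun u => 1 + σ * u) σ u := fun u => by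
    simpa using ((hasDerivAt_id u).const_mul σ).const_add 1
  have hlog : ∀ u ∈ Set.Icc 0 U,
      HasDerivAt (fun u => Real.log (1 + σ * u)) (σ / (1 + σ * u)) u := fun u hu =>
    (haff u).log (by linarith [(hb u hu).1])
  refine norm_integral_exp_sub_halfFresnel_le (d := fun u => σ * Real.log (1 + σ * u))
    (m := fun u => 1 / (1 + σ * u)) hU ?_ hκ ?_ ?_ ?_ (by simp) (by simp) ?_
  · rcases hσ with rfl | rfl <;> linarith
  · intro u hu
    have h0 : 1 + σ * u ≠ 0 := by linarith [(hb u hu).1]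
    refine (((haff u).mul (hlog u hu)).sub ((haff u).sub_const 1)).congr_deriv ?_
      |>.congr_of_eventuallyEq ?_
    · field_simp
      ring
    · exact Eventually.of_forall fun u => by simp
  · intro u hu
    refine ((hlog u hu).const_mul σ).congr_deriv ?_
    rw [← mul_div_assoc, hσ2]
  · refine continuousOn_const.div (by fun_prop) fun u hu => ?_
    linarith [(hb u hu).1]
  · intro u hu
    obtain ⟨b1, b2⟩ := hb u hu
    have h0 : 0 < 1 + σ * u := by linarith
    refine ⟨?_, ?_, ?_⟩
    · rw [div_le_div_iff₀ (by norm_num) h0]; linarith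
    · rw [div_le_iff₀ h0]; linarith
    · rw [div_sub_one h0.ne', abs_div, abs_of_pos h0, div_le_iff₀ h0]
      have : |1 - (1 + σ * u)| = u := by
        rcases hσ with rfl | rfl
        · rw [abs_of_nonpos] <;> linarith [hu.1]
        · rw [abs_of_nonneg] <;> linarith [hu.1]
      rw [this]
      nlinarith [hu.1]

lemma integral_exp_phase_eq {κ σ U : ℝ} (hκ : 0 < κ) :
    ∫ t in κ..κ + κ * σ * U, Complex.exp (I * (phase κ t : ℝ)) =
      σ * κ * Complex.exp (-(I * κ)) * ∫ u in (0 : ℝ)..U,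
        Complex.exp (I * (κ * ((1 + σ * u) * Real.log (1 + σ * u) - σ * u) : ℝ)) := by
  have := intervalIntegral.smul_integral_comp_add_mul
    (fun t => Complex.exp (I * (phase κ t : ℝ))) (a := 0) (b := U) (κ * σ) κ
  rw [mul_zero, add_zero] at this
  rw [← this, ← intervalIntegral.integral_smul, ← intervalIntegral.integral_const_mul]
  refine intervalIntegral.integral_congr fun u _ => ?_
  have e : phase κ (κ + κ * σ * u) =
      κ * ((1 + σ * u) * Real.log (1 + σ * u) - σ * u) - κ := by
    rw [phase, show (κ + κ * σ * u) / κ = 1 + σ * u by field_simp]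
    ring
  simp only [e, Complex.real_smul]
  rw [mul_assoc (σ * κ : ℂ), ← Complex.exp_add]
  push_cast
  rw [mul_comm (κ : ℂ) σ]
  congr 2
  ring

lemma norm_integral_exp_phase_sub_le {κ σ A : ℝ} (hκ : 1 ≤ κ)
    (hσ : σ = 1 ∧ κ < A ∨ σ = -1 ∧ A < κ) (h1 : κ / 4 ≤ A) (h4 : A ≤ 4 * κ) :
    ‖(∫ t in κ..A, Complex.exp (I * (phase κ t : ℝ))) -
      σ * κ * Complex.exp (-(I * κ)) * halfFresnel κ‖ ≤
        130000 * (1 + Real.log κ + κ / |A - κ|) := by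
  have hκ0 : 0 < κ := by linarith
  have hσ' : σ = 1 ∨ σ = -1 := hσ.imp And.left And.left
  have hσ2 : σ * σ = 1 := by rcases hσ' with rfl | rfl <;> norm_num
  have hne : A - κ ≠ 0 := by
    rcases hσ with h | h
    · linarith [h.2]
    · linarith [h.2]
  have habs : |A - κ| = σ * (A - κ) := by
    rcases hσ with ⟨rfl, h⟩ | ⟨rfl, h⟩
    · rw [abs_of_pos] <;> linarith
    · rw [abs_of_neg] <;> linarith
  set U := |A - κ| / κ with hU
  have hU0 : 0 < U := by positivity
  have hsU : σ * U = A / κ - 1 := by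
    rw [hU, habs, ← mul_div_assoc, ← mul_assoc, hσ2]
    field_simp
  have hA : A = κ + κ * σ * U := by
    rw [mul_assoc, hsU]
    field_simp
    ring
  have hb := norm_integral_exp_entropy_sub_halfFresnel_le hκ hσ' hU0
    (by rw [hsU]; have : 1 / 4 ≤ A / κ := by
          rw [le_div_iff₀ hκ0]; linarith
        linarith)
    (by rw [hsU]; have : A / κ ≤ 4 := by
          rwa [div_le_iff₀ hκ0]
        linarith)
  nth_rw 1 [hA]
  rw [integral_exp_phase_eq hκ0, ← mul_sub, norm_mul]
  have hn : ‖(σ * κ * Complex.exp (-(I * κ)) : ℂ)‖ = κ := by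
    rw [norm_mul, norm_mul, show (-(I * κ) : ℂ) = I * ((-κ : ℝ) : ℂ) by push_cast; ring,
      norm_exp_I_mul, Complex.norm_real, Complex.norm_real, mul_one, Real.norm_of_nonneg hκ0.le]
    rcases hσ' with rfl | rfl <;> simp
  rw [hn]
  calc _ ≤ κ * (130000 * ((1 + Real.log κ) / κ + 1 / (κ * U))) := by gcongr
    _ = _ := by
      rw [hU]
      field_simp

lemma norm_integral_exp_phase_le_sqrt {κ A : ℝ} (hκ : 1 ≤ κ) (h1 : κ / 4 ≤ A) (h4 : A ≤ 4 * κ) :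
    ‖∫ t in κ..A, Complex.exp (I * (phase κ t : ℝ))‖ ≤ 400000 * √κ := by
  have hκ0 : 0 < κ := by linarith
  have hs : 1 ≤ √κ := Real.one_le_sqrt.mpr hκ
  rcases le_or_gt |A - κ| (√κ) with h | h
  · have : ‖∫ t in κ..A, Complex.exp (I * (phase κ t : ℝ))‖ ≤ 1 * |A - κ| :=
      intervalIntegral.norm_integral_le_of_norm_le_const fun t _ => (norm_exp_I_mul _).le
    linarith
  · have hne : A ≠ κ := by
      rintro rfl
      simp only [sub_self, abs_zero] at h
      linarith
    obtain ⟨σ, hσ, hs1⟩ : ∃ σ : ℝ, (σ = 1 ∧ κ < A ∨ σ = -1 ∧ A < κ) ∧ |σ| = 1 := by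
      rcases lt_or_gt_of_ne hne with h | h
      · exact ⟨-1, Or.inr ⟨rfl, h⟩, by simp⟩
      · exact ⟨1, Or.inl ⟨rfl, h⟩, by simp⟩
    have hb := norm_integral_exp_phase_sub_le hκ hσ h1 h4
    set Q := ∫ t in κ..A, Complex.exp (I * (phase κ t : ℝ))
    have hm : ‖(σ * κ * Complex.exp (-(I * κ)) * halfFresnel κ : ℂ)‖ ≤ 2 * √κ := by
      rw [norm_mul, norm_mul, norm_mul,
        show (-(I * κ) : ℂ) = I * ((-κ : ℝ) : ℂ) by push_cast; ring,
        norm_exp_I_mul, Complex.norm_real, Complex.norm_real, mul_one,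
        Real.norm_of_nonneg hκ0.le, Real.norm_eq_abs, hs1, one_mul]
      calc _ ≤ κ * (2 / √κ) := by gcongr; exact norm_halfFresnel_le hκ0
        _ = 2 * (κ / √κ) := by ring
        _ = _ := by rw [Real.div_sqrt]
    have hlog : Real.log κ ≤ 2 * √κ - 2 := by
      have := Real.log_le_sub_one_of_pos (Real.sqrt_pos.mpr hκ0)
      rw [Real.log_sqrt hκ0.le] at this
      linarith
    have hq : κ / |A - κ| ≤ √κ := by
      rw [div_le_iff₀ (by linarith)]
      nlinarith [Real.mul_self_sqrt hκ0.le]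
    have := norm_le_norm_add_norm_sub' Q (σ * κ * Complex.exp (-(I * κ)) * halfFresnel κ)
    linarith

lemma hasDerivAt_phase {κ t : ℝ} (hκ : κ ≠ 0) (ht : t ≠ 0) :
    HasDerivAt (phase κ) (Real.log (t / κ)) t := by
  have h1 := ((hasDerivAt_id t).div_const κ).log (div_ne_zero ht hκ)
  refine (((hasDerivAt_id t).mul h1).sub (hasDerivAt_id t)).congr_deriv ?_
  simp only [id]
  field_simp
  ring

lemma norm_integral_mul_exp_phase_le {κ a b l M : ℝ} (hκ : 0 < κ) (ha : 0 < a) (hab : a ≤ b)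
    (hb : b ≤ 2 * a) (hl : 0 < l) (hM : 0 ≤ M) {w w' : ℝ → ℝ}
    (hw : ∀ t ∈ Set.Icc a b, HasDerivAt w (w' t) t) (hw' : ContinuousOn w' (Set.Icc a b))
    (hw1 : ∀ t ∈ Set.Icc a b, |w t| ≤ 1) (hwM : ∀ t ∈ Set.Icc a b, |w' t| ≤ M / t)
    (hlog : ∀ t ∈ Set.Icc a b, l ≤ |Real.log (t / κ)|) :
    ‖∫ t in a..b, (w t : ℂ) * Complex.exp (I * (phase κ t : ℝ))‖ ≤ (4 + M) / l := by
  set L : ℝ → ℝ := fun t => Real.log (t / κ) with hL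
  have hpos : ∀ t ∈ Set.Icc a b, 0 < t := fun t ht => ha.trans_le ht.1
  have hL0 : ∀ t ∈ Set.Icc a b, L t ≠ 0 := fun t ht => abs_pos.mp (hl.trans_le (hlog t ht))
  have hLd : ∀ t ∈ Set.Icc a b, HasDerivAt L (1 / t) t := fun t ht => by
    have ht0 := (hpos t ht).ne'
    refine (((hasDerivAt_id t).div_const κ).log (div_ne_zero ht0 hκ.ne')).congr_deriv ?_
    simp only [id]
    field_simp
  have hLc : ContinuousOn L (Set.Icc a b) := fun t ht =>
    (hLd t ht).continuousAt.continuousWithinAt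
  have hwc : ContinuousOn w (Set.Icc a b) := fun t ht => (hw t ht).continuousAt.continuousWithinAt
  have hid : ContinuousOn (fun t : ℝ => 1 / t) (Set.Icc a b) :=
    continuousOn_const.div continuousOn_id fun t ht => (hpos t ht).ne'
  have hr : ∀ t ∈ Set.Icc a b, HasDerivAt (fun t => w t / L t)
      ((w' t * L t - w t * (1 / t)) / L t ^ 2) t := fun t ht =>
    (hw t ht).div (hLd t ht) (hL0 t ht)
  have hrc : ContinuousOn (fun t => (w' t * L t - w t * (1 / t)) / L t ^ 2) (Set.Icc a b) :=
    ((hw'.mul hLc).sub (hwc.mul hid)).div (hLc.pow 2) fun t ht => pow_ne_zero 2 (hL0 t ht)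
  have hn : ∀ r : ℝ, ‖(r : ℂ) * (-I)‖ = |r| := fun r => by
    rw [norm_mul, norm_neg, Complex.norm_I, mul_one, Complex.norm_real, Real.norm_eq_abs]
  have hinv : ∀ t ∈ Set.Icc a b, |1 / L t| ≤ 1 / l := fun t ht => by
    rw [abs_div, abs_one]
    exact one_div_le_one_div_of_le hl (hlog t ht)
  have hwl : ∀ t ∈ Set.Icc a b, |w t / L t| ≤ 1 / l := fun t ht => by
    rw [abs_div]
    exact div_le_div₀ zero_le_one (hw1 t ht) hl (hlog t ht)
  have haI : a ∈ Set.Icc a b := Set.left_mem_Icc.mpr hab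
  have hbI : b ∈ Set.Icc a b := Set.right_mem_Icc.mpr hab
  have hibp := norm_integral_mul_deriv_exp_le hab (g := fun t => (w t / L t : ℝ) * (-I))
    (g' := fun t => ((w' t * L t - w t * (1 / t)) / L t ^ 2 : ℝ) * (-I))
    (ψ := fun t => I * (phase κ t : ℝ)) (ψ' := fun t => I * (L t : ℝ))
    (fun t ht => (hr t ht).ofReal_comp.mul_const _)
    (fun t ht => ((hasDerivAt_phase hκ.ne' (hpos t ht).ne').ofReal_comp).const_mul I)
    ((Complex.continuous_ofReal.comp_continuousOn hrc).mul continuousOn_const)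
    (continuousOn_const.mul (Complex.continuous_ofReal.comp_continuousOn hLc))
    (fun t _ => by simp)
  simp only [hn] at hibp
  have heq : ∫ t in a..b, (w t : ℂ) * Complex.exp (I * (phase κ t : ℝ)) =
      ∫ t in a..b, ((w t / L t : ℝ) * (-I)) *
        (I * (L t : ℝ) * Complex.exp (I * (phase κ t : ℝ))) := by
    refine intervalIntegral.integral_congr fun t ht => ?_
    rw [Set.uIcc_of_le hab] at ht
    have e : (L t : ℂ) ≠ 0 := by exact_mod_cast hL0 t ht
    push_cast
    field_simp
    ring_nf
    simp
  have hint : ∫ t in a..b, |(w' t * L t - w t * (1 / t)) / L t ^ 2| ≤ M / l + 2 / l := by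
    have hG : ∀ t ∈ Set.uIcc a b, HasDerivAt (fun t => M / l * Real.log t - 1 / L t)
        (M / l * (1 / t) + (1 / t) / L t ^ 2) t := fun t ht => by
      rw [Set.uIcc_of_le hab] at ht
      have h1 := (Real.hasDerivAt_log (hpos t ht).ne').const_mul (M / l)
      have h2 := (hLd t ht).inv (hL0 t ht)
      simp only [one_div] at h2 ⊢
      refine (h1.sub h2).congr_deriv ?_
      ring
    have hGc : ContinuousOn (fun t => M / l * (1 / t) + (1 / t) / L t ^ 2) (Set.Icc a b) :=
      (continuousOn_const.mul hid).add
        (hid.div (hLc.pow 2) fun t ht => pow_ne_zero 2 (hL0 t ht))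
    have hGi : IntervalIntegrable (fun t => M / l * (1 / t) + (1 / t) / L t ^ 2) volume a b :=
      ContinuousOn.intervalIntegrable (by rwa [Set.uIcc_of_le hab])
    have hle : ∫ t in a..b, |(w' t * L t - w t * (1 / t)) / L t ^ 2| ≤
        ∫ t in a..b, (M / l * (1 / t) + (1 / t) / L t ^ 2) := by
      refine intervalIntegral.integral_mono_on hab (ContinuousOn.intervalIntegrable ?_) hGi
        fun t ht => ?_
      · rw [Set.uIcc_of_le hab]
        exact hrc.abs
      · have ht0 := hpos t ht
        have hLt := hL0 t ht
        have e : (w' t * L t - w t * (1 / t)) / L t ^ 2 =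
            w' t * (1 / L t) - w t * ((1 / t) / L t ^ 2) := by
          field_simp
        rw [e]
        refine (abs_sub _ _).trans ?_
        rw [abs_mul, abs_mul, abs_of_nonneg (by positivity : 0 ≤ 1 / t / L t ^ 2)]
        have h1 : |w' t| * |1 / L t| ≤ M / t * (1 / l) := by
          gcongr
          · exact hwM t ht
          · exact hinv t ht
        have h2 : |w t| * (1 / t / L t ^ 2) ≤ 1 * (1 / t / L t ^ 2) := by
          gcongr
          exact hw1 t ht
        calc _ ≤ M / t * (1 / l) + 1 * (1 / t / L t ^ 2) := add_le_add h1 h2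
          _ = _ := by ring
    refine hle.trans ?_
    rw [intervalIntegral.integral_eq_sub_of_hasDerivAt hG hGi]
    have h1 : Real.log b - Real.log a ≤ 1 := by
      rw [← Real.log_div (ha.trans_le hab).ne' ha.ne']
      have := Real.log_le_sub_one_of_pos (div_pos (ha.trans_le hab) ha)
      have h2 : b / a ≤ 2 := by rwa [div_le_iff₀ ha]
      linarith
    have h2 := (abs_le.mp (hinv a haI)).2
    have h3 := (abs_le.mp (hinv b hbI)).1
    have h4 : M / l * (Real.log b - Real.log a) ≤ M / l * 1 := by gcongr
    have h5 : 2 / l = 1 / l + 1 / l := by ring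
    linarith
  rw [heq]
  refine hibp.trans ?_
  have h1 := hwl a haI
  have h2 := hwl b hbI
  have h3 : (4 + M) / l = 1 / l + 1 / l + (M / l + 2 / l) := by ring
  linarith

lemma one_sub_div_le_log_div {x y : ℝ} (hx : 0 < x) (hy : 0 < y) :
    1 - x / y ≤ Real.log (y / x) := by
  have := Real.one_sub_inv_le_log_of_pos (div_pos hy hx)
  rwa [inv_div] at this

lemma le_abs_log_div {T κ t l : ℝ} (hT : 0 < T) (hκ : 0 < κ) (ht : t ∈ Set.Icc T (2 * T))
    (h : κ ≤ T * (1 - l) ∨ 2 * T ≤ κ * (1 - l)) : l ≤ |Real.log (t / κ)| := by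
  have ht0 : 0 < t := hT.trans_le ht.1
  rcases h with h | h
  · refine le_trans ?_ ((one_sub_div_le_log_div hκ ht0).trans (le_abs_self _))
    have : κ / t ≤ 1 - l := by
      have h1 : 0 ≤ 1 - l := by
        by_contra! hneg
        nlinarith
      rw [div_le_iff₀ ht0]
      nlinarith [ht.1]
    linarith
  · rw [← abs_neg, ← Real.log_inv, inv_div]
    refine le_trans ?_ ((one_sub_div_le_log_div ht0 hκ).trans (le_abs_self _))
    have : t / κ ≤ 1 - l := by
      rw [div_le_iff₀ hκ]
      linarith [ht.2]
    linarith

lemma intervalIntegrable_exp_phase {κ a b : ℝ} (hκ : 0 < κ) (ha : 0 < a) (hb : 0 < b) :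
    IntervalIntegrable (fun t => Complex.exp (I * (phase κ t : ℝ))) volume a b :=
  ContinuousOn.intervalIntegrable fun t ht => by
    have ht0 : t ≠ 0 := ((lt_min ha hb).trans_le ht.1).ne'
    have := (hasDerivAt_phase hκ.ne' ht0).continuousAt
    have : ContinuousAt (fun t => Complex.exp (I * (phase κ t : ℝ))) t := by fun_prop
    exact this.continuousWithinAt

lemma norm_integral_exp_phase_dyadic_le {T κ : ℝ} (hκ1 : 1 ≤ κ) (h1 : T ≤ 2 * κ)
    (h2 : κ ≤ 4 * T) :
    ‖∫ t in T..(2 * T), Complex.exp (I * (phase κ t : ℝ))‖ ≤ 800000 * √κ := by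
  rw [← intervalIntegral.integral_interval_sub_left (a := κ)
    (intervalIntegrable_exp_phase (by linarith) (by linarith) (by linarith))
    (intervalIntegrable_exp_phase (by linarith) (by linarith) (by linarith))]
  refine (norm_sub_le _ _).trans ?_
  have := norm_integral_exp_phase_le_sqrt (A := T) hκ1 (by linarith) (by linarith)
  have := norm_integral_exp_phase_le_sqrt (A := 2 * T) hκ1 (by linarith) (by linarith)
  linarith

lemma norm_integral_exp_phase_dyadic_sub_le {T κ q : ℝ} (hq : 1 ≤ q) (hT : T = q ^ 4)
    (h1 : T + q ^ 3 ≤ κ) (h2 : κ ≤ 2 * T - q ^ 3) :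
    ‖(∫ t in T..(2 * T), Complex.exp (I * (phase κ t : ℝ))) -
      2 * κ * Complex.exp (-(I * κ)) * halfFresnel κ‖ ≤ 2080000 * q := by
  have hq3 : 0 < q ^ 3 := by positivity
  have hT1 : 1 ≤ T := by rw [hT]; exact one_le_pow₀ hq
  have hκ1 : 1 ≤ κ := by linarith
  rw [← intervalIntegral.integral_interval_sub_left (a := κ)
    (intervalIntegrable_exp_phase (by linarith) (by linarith) (by linarith))
    (intervalIntegrable_exp_phase (by linarith) (by linarith) (by linarith))]
  have b1 := norm_integral_exp_phase_sub_le (A := T) hκ1 (Or.inr ⟨rfl, by linarith⟩)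
    (by linarith) (by linarith)
  have b2 := norm_integral_exp_phase_sub_le (A := 2 * T) hκ1 (Or.inl ⟨rfl, by linarith⟩)
    (by linarith) (by linarith)
  have hquot : ∀ y, q ^ 3 ≤ |y| → κ / |y| ≤ 2 * q := fun y hy => by
    rw [div_le_iff₀ (hq3.trans_le hy)]
    calc κ ≤ 2 * q * q ^ 3 := by rw [show 2 * q * q ^ 3 = 2 * q ^ 4 by ring, ← hT]; linarith
      _ ≤ _ := by gcongr
  have q1 := hquot (T - κ) (by rw [abs_of_neg] <;> linarith)
  have q2 := hquot (2 * T - κ) (by rw [abs_of_pos] <;> linarith)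
  have hlog : Real.log κ ≤ 5 * q := by
    have e1 : Real.log κ ≤ Real.log (2 * T) := Real.log_le_log (by linarith) (by linarith)
    have e2 := Real.log_le_sub_one_of_pos (by linarith : 0 < q)
    have e3 := Real.log_le_sub_one_of_pos (by norm_num : (0 : ℝ) < 2)
    rw [Real.log_mul (by norm_num) (by linarith), hT, Real.log_pow] at e1
    push_cast at e1
    linarith
  set A := ∫ t in κ..T, Complex.exp (I * (phase κ t : ℝ))
  set B := ∫ t in κ..2 * T, Complex.exp (I * (phase κ t : ℝ))
  rw [show B - A - 2 * κ * Complex.exp (-(I * κ)) * halfFresnel κ =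
    (B - (1 : ℝ) * κ * Complex.exp (-(I * κ)) * halfFresnel κ) -
      (A - (-1 : ℝ) * κ * Complex.exp (-(I * κ)) * halfFresnel κ) by push_cast; ring]
  refine (norm_sub_le _ _).trans ?_
  linarith

lemma integral_exp_main_term {k : ℕ} (hk : k ≠ 0) :
    Complex.exp (-(π / 4 * I)) * (2 * (2 * π * k : ℝ) * Complex.exp (-(I * (2 * π * k : ℝ))) *
      halfFresnel (2 * π * k)) = (2 * π * √k : ℝ) := by
  have hk0 : (0 : ℝ) < k := by exact_mod_cast Nat.pos_of_ne_zero hk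
  have e1 : Complex.exp (-(I * (2 * π * k : ℝ))) = 1 := by
    rw [Complex.exp_eq_one_iff]
    exact ⟨-k, by push_cast; ring⟩
  have e2 : √(2 * π / (2 * π * k)) = √k / k := by
    rw [show 2 * π / (2 * π * k) = (k : ℝ)⁻¹ by field_simp, Real.sqrt_inv,
      inv_eq_one_div, div_eq_div_iff (by positivity) (by positivity),
      Real.mul_self_sqrt hk0.le, one_mul]
  have e3 : Complex.exp (-(π / 4 * I)) * Complex.exp (π / 4 * I) = 1 := by
    rw [← Complex.exp_add, neg_add_cancel, Complex.exp_zero]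
  rw [e1, halfFresnel, e2, mul_one]
  have hkc : (k : ℂ) ≠ 0 := by exact_mod_cast hk
  calc _ = (Complex.exp (-(π / 4 * I)) * Complex.exp (π / 4 * I)) *
        (2 * (2 * π * k : ℝ) * (√k / k / 2 : ℝ)) := by ring
    _ = _ := by
      rw [e3]
      push_cast
      field_simp

/-- The weight `ρ (k / x t)` with `x t = 2 * (t / (2 * π)) ^ (3 / 2)`. -/
noncomputable def smoothWeight (ρ : ℝ → ℝ) (k t : ℝ) : ℝ :=
  ρ (k / (2 * (t / (2 * π)) ^ ((3 : ℝ) / 2)))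

section cutoff

variable {ρ : ℝ → ℝ}

lemma cutoff_abs_le_one (hρ_nonneg : ∀ u : ℝ, 0 < u → 0 ≤ ρ u)
    (hρ_fe : ∀ u : ℝ, 0 < u → ρ u + ρ (1 / u) = 1) {u : ℝ} (hu : 0 < u) : |ρ u| ≤ 1 := by
  rw [abs_of_nonneg (hρ_nonneg u hu)]
  linarith [hρ_fe u hu, hρ_nonneg (1 / u) (by positivity)]

lemma cutoff_eq_one (hρ_fe : ∀ u : ℝ, 0 < u → ρ u + ρ (1 / u) = 1)
    (hρ_supp : ∀ u : ℝ, 2 ≤ u → ρ u = 0) {u : ℝ} (hu : 0 < u) (hu2 : u ≤ 1 / 2) : ρ u = 1 := by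
  have := hρ_fe u hu
  rwa [hρ_supp (1 / u) (by rw [le_div_iff₀ hu]; linarith), add_zero] at this

lemma exists_cutoff_abs_mul_deriv_le (hρ_smooth : ContDiffOn ℝ (⊤ : ℕ∞) ρ (Set.Ioi 0))
    (hρ_fe : ∀ u : ℝ, 0 < u → ρ u + ρ (1 / u) = 1)
    (hρ_supp : ∀ u : ℝ, 2 ≤ u → ρ u = 0) :
    ∃ M, 0 ≤ M ∧ ∀ u, 0 < u → |u * deriv ρ u| ≤ M := by
  have hc : ContinuousOn (fun u => u * deriv ρ u) (Set.Icc (1 / 2) 2) :=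
    continuousOn_id.mul ((hρ_smooth.continuousOn_deriv_of_isOpen isOpen_Ioi
      (by exact_mod_cast le_top)).mono fun u hu => lt_of_lt_of_le (by norm_num) hu.1)
  obtain ⟨M, hM⟩ := isCompact_Icc.exists_bound_of_continuousOn hc
  refine ⟨max M 0, le_max_right _ _, fun u hu => ?_⟩
  rcases lt_or_ge u (1 / 2) with h | h
  · have : ρ =ᶠ[nhds u] fun _ => 1 := by
      filter_upwards [Ioo_mem_nhds hu h] with v hv
      exact cutoff_eq_one hρ_fe hρ_supp hv.1 hv.2.le
    rw [this.deriv_eq]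
    simp
  rcases lt_or_ge 2 u with h2 | h2
  · have : ρ =ᶠ[nhds u] fun _ => 0 := by
      filter_upwards [Ioi_mem_nhds h2] with v hv
      exact hρ_supp v (le_of_lt hv)
    rw [this.deriv_eq]
    simp
  · exact (hM u ⟨h, h2⟩).trans (le_max_left _ _)

lemma exists_smoothWeight_deriv_le (hρ_smooth : ContDiffOn ℝ (⊤ : ℕ∞) ρ (Set.Ioi 0))
    (hρ_fe : ∀ u : ℝ, 0 < u → ρ u + ρ (1 / u) = 1)
    (hρ_supp : ∀ u : ℝ, 2 ≤ u → ρ u = 0) :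
    ∃ M, 0 ≤ M ∧ ∀ k : ℝ, 0 < k → ∃ w' : ℝ → ℝ, ContinuousOn w' (Set.Ioi 0) ∧
      ∀ t, 0 < t → HasDerivAt (smoothWeight ρ k) (w' t) t ∧ |w' t| ≤ M / t := by
  obtain ⟨M, hM0, hM⟩ := exists_cutoff_abs_mul_deriv_le hρ_smooth hρ_fe hρ_supp
  refine ⟨3 / 2 * M, by positivity, fun k hk => ?_⟩
  set v : ℝ → ℝ := fun t => k / (2 * (t / (2 * π)) ^ ((3 : ℝ) / 2)) with hv
  have hvpos : ∀ t, 0 < t → 0 < v t := fun t ht => by positivity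
  have hvd : ∀ t, 0 < t → HasDerivAt v (-(3 / 2) * v t / t) t := fun t ht => by
    have hx : 0 < t / (2 * π) := by positivity
    have h1 := (((hasDerivAt_id t).div_const (2 * π)).rpow_const (p := (3 : ℝ) / 2)
      (Or.inl hx.ne')).const_mul 2
    have h2 := (hasDerivAt_const t k).div h1 (by simp only [id]; positivity)
    refine h2.congr_deriv ?_
    simp only [hv, id]
    rw [Real.rpow_sub_one hx.ne']
    field_simp
    ring
  have hρd : ∀ u, 0 < u → HasDerivAt ρ (deriv ρ u) u := fun u hu =>
    ((hρ_smooth.differentiableOn (by simp)).differentiableAt (Ioi_mem_nhds hu)).hasDerivAt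
  have hvc : ContinuousOn v (Set.Ioi 0) := fun t ht => (hvd t ht).continuousAt.continuousWithinAt
  have hρc : ContinuousOn (deriv ρ) (Set.Ioi 0) :=
    hρ_smooth.continuousOn_deriv_of_isOpen isOpen_Ioi (by exact_mod_cast le_top)
  refine ⟨fun t => deriv ρ (v t) * (-(3 / 2) * v t / t), ?_, fun t ht => ⟨?_, ?_⟩⟩
  · exact (hρc.comp hvc fun t ht => hvpos t ht).mul
      ((continuousOn_const.mul hvc).div continuousOn_id fun t ht => ne_of_gt ht)
  · exact (hρd (v t) (hvpos t ht)).comp t (hvd t ht)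
  · have := hM (v t) (hvpos t ht)
    change |deriv ρ (v t) * (-(3 / 2) * v t / t)| ≤ _
    rw [show deriv ρ (v t) * (-(3 / 2) * v t / t) = -(3 / 2 * (v t * deriv ρ (v t)) / t) by ring,
      abs_neg, abs_div, abs_of_pos ht, abs_mul, abs_of_pos (by norm_num : (0 : ℝ) < 3 / 2)]
    gcongr

lemma smoothWeight_abs_le_one (hρ_nonneg : ∀ u : ℝ, 0 < u → 0 ≤ ρ u)
    (hρ_fe : ∀ u : ℝ, 0 < u → ρ u + ρ (1 / u) = 1) {k t : ℝ} (hk : 0 < k) (ht : 0 < t) :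
    |smoothWeight ρ k t| ≤ 1 :=
  cutoff_abs_le_one hρ_nonneg hρ_fe (by positivity)

lemma smoothWeight_eq_one (hρ_fe : ∀ u : ℝ, 0 < u → ρ u + ρ (1 / u) = 1)
    (hρ_supp : ∀ u : ℝ, 2 ≤ u → ρ u = 0) {k t : ℝ} (hk : 0 < k) (ht : 400 ≤ t)
    (hkt : 2 * π * k ≤ 4 * t) : smoothWeight ρ k t = 1 := by
  have hx : 0 < t / (2 * π) := by positivity
  refine cutoff_eq_one hρ_fe hρ_supp (by positivity) ?_
  rw [div_le_div_iff₀ (by positivity) (by norm_num), one_mul,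
    show (3 : ℝ) / 2 = 1 + 1 / 2 by norm_num, Real.rpow_add hx, Real.rpow_one, ← Real.sqrt_eq_rpow]
  have h1 : 4 ≤ √(t / (2 * π)) := by
    refine Real.le_sqrt_of_sq_le ?_
    rw [le_div_iff₀ (by positivity)]
    nlinarith [Real.pi_lt_four]
  have h2 : k ≤ t / (2 * π) * 4 := by
    rw [div_mul_eq_mul_div, le_div_iff₀ (by positivity)]
    linarith
  nlinarith

lemma smoothWeight_eq_zero (hρ_supp : ∀ u : ℝ, 2 ≤ u → ρ u = 0) {T k t : ℝ} (hT : 0 < T)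
    (ht : t ∈ Set.Icc T (2 * T)) (hk : T ^ ((3 : ℝ) / 2) ≤ k) : smoothWeight ρ k t = 0 := by
  have ht0 : 0 < t := hT.trans_le ht.1
  refine hρ_supp _ ?_
  rw [le_div_iff₀ (by positivity), ← mul_assoc]
  refine le_trans ?_ hk
  have h1 : (t / (2 * π)) ^ ((3 : ℝ) / 2) ≤ (T / π) ^ ((3 : ℝ) / 2) := by
    refine Real.rpow_le_rpow (by positivity) ?_ (by norm_num)
    rw [div_le_div_iff₀ (by positivity) (by positivity)]
    nlinarith [ht.2, Real.pi_pos]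
  have h2 : 4 ≤ π ^ ((3 : ℝ) / 2) := by
    rw [show (3 : ℝ) / 2 = 1 + 1 / 2 by norm_num, Real.rpow_add Real.pi_pos, Real.rpow_one,
      ← Real.sqrt_eq_rpow]
    have : 1.4 ≤ √π := Real.le_sqrt_of_sq_le (by linarith [Real.pi_gt_three])
    nlinarith [Real.pi_gt_three]
  rw [Real.div_rpow hT.le Real.pi_pos.le] at h1
  calc 2 * 2 * (t / (2 * π)) ^ ((3 : ℝ) / 2)
      ≤ 4 * (T ^ ((3 : ℝ) / 2) / π ^ ((3 : ℝ) / 2)) := by linarith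
    _ ≤ 4 * (T ^ ((3 : ℝ) / 2) / 4) := by gcongr
    _ = _ := by ring

end cutoff

/-- The integral that multiplies `d3 k * k ^ (-1 / 2)` in the smoothed sum. -/
noncomputable def weightedIntegral (ρ : ℝ → ℝ) (T : ℝ) (k : ℕ) : ℂ :=
  ∫ t in T..(2 * T), ((smoothWeight ρ k t : ℝ) : ℂ) * (k : ℂ) ^ (-(I * t)) *
    (chi (1 / 2 + I * t))⁻¹

/-- The weight of the index `k` in the sum over `T / (2 * π) ≤ k ≤ T / π` with halved endpoints. -/
noncomputable def endpointWeight (T : ℝ) (k : ℕ) : ℂ :=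
  if T / (2 * π) ≤ k ∧ k ≤ T / π then
    (if (k : ℝ) = T / (2 * π) ∨ (k : ℝ) = T / π then (1 / 2 : ℂ) else 1) else 0

lemma natCast_cpow_mul_exp_phase {k : ℕ} (hk : k ≠ 0) {t : ℝ} (ht : 0 < t) :
    (k : ℂ) ^ (-(I * t)) * Complex.exp (I * (phase (2 * π) t : ℝ)) =
      Complex.exp (I * (phase (2 * π * k) t : ℝ)) := by
  have hk0 : (0 : ℝ) < k := by exact_mod_cast Nat.pos_of_ne_zero hk
  have e : phase (2 * π * k) t = phase (2 * π) t - t * Real.log k := by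
    rw [phase, phase, ← div_div, Real.log_div (by positivity) hk0.ne']
    ring
  rw [Complex.cpow_def_of_ne_zero (by exact_mod_cast hk), ← Complex.exp_add, e,
    ← Complex.natCast_log]
  push_cast
  congr 1
  ring

lemma norm_natCast_cpow_neg_I_mul {k : ℕ} (hk : k ≠ 0) (t : ℝ) :
    ‖(k : ℂ) ^ (-(I * t))‖ = 1 := by
  rw [Complex.norm_natCast_cpow_of_pos (Nat.pos_of_ne_zero hk)]
  simp

lemma norm_weightedIntegral_sub_le {ρ : ℝ → ℝ} {T : ℝ} {k : ℕ} (hT : 9 ≤ T) (hk : k ≠ 0)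
    (hw : ContinuousOn (smoothWeight ρ k) (Set.Icc T (2 * T)))
    (hw1 : ∀ t ∈ Set.Icc T (2 * T), |smoothWeight ρ k t| ≤ 1) :
    ‖weightedIntegral ρ T k - Complex.exp (-(π / 4 * I)) *
      ∫ t in T..(2 * T), (smoothWeight ρ k t : ℂ) *
        Complex.exp (I * (phase (2 * π * k) t : ℝ))‖ ≤ 38 := by
  have hk0 : (0 : ℝ) < k := by exact_mod_cast Nat.pos_of_ne_zero hk
  have hkc : (k : ℂ) ≠ 0 := by exact_mod_cast hk
  have hTT : T ≤ 2 * T := by linarith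
  have hwc := Complex.continuous_ofReal.comp_continuousOn hw
  have i1 : IntervalIntegrable (fun t : ℝ => ((smoothWeight ρ k t : ℝ) : ℂ) *
      (k : ℂ) ^ (-(I * t)) * (chi (1 / 2 + I * t))⁻¹) volume T (2 * T) := by
    refine ContinuousOn.intervalIntegrable ?_
    rw [Set.uIcc_of_le hTT]
    refine (hwc.mul ?_).mul (continuousOn_inv_chi.mono fun t ht => ?_)
    · exact Continuous.continuousOn (by
        refine Continuous.const_cpow (by fun_prop) (Or.inl hkc))
    · exact le_trans (by linarith) ht.1
  have i2 : IntervalIntegrable (fun t : ℝ => Complex.exp (-(π / 4 * I)) *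
      ((smoothWeight ρ k t : ℂ) * Complex.exp (I * (phase (2 * π * k) t : ℝ))))
      volume T (2 * T) := by
    refine ((intervalIntegrable_exp_phase (by positivity) (by linarith)
      (by linarith)).continuousOn_mul ?_).const_mul _
    rwa [Set.uIcc_of_le hTT]
  rw [weightedIntegral, ← intervalIntegral.integral_const_mul,
    ← intervalIntegral.integral_sub i1 i2]
  refine (intervalIntegral.norm_integral_le_of_norm_le_const (C := 38 / T) fun t ht => ?_).trans ?_
  · rw [Set.uIoc_of_le hTT] at ht
    have ht' : t ∈ Set.Icc T (2 * T) := Set.Ioc_subset_Icc_self ht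
    have ht0 : 0 < t := by linarith [ht.1]
    rw [← natCast_cpow_mul_exp_phase hk ht0]
    rw [show (smoothWeight ρ k t : ℂ) * (k : ℂ) ^ (-(I * t)) * (chi (1 / 2 + I * t))⁻¹ -
      Complex.exp (-(π / 4 * I)) * ((smoothWeight ρ k t : ℂ) *
        ((k : ℂ) ^ (-(I * t)) * Complex.exp (I * (phase (2 * π) t : ℝ)))) =
      (smoothWeight ρ k t : ℂ) * (k : ℂ) ^ (-(I * t)) * ((chi (1 / 2 + I * t))⁻¹ -
        Complex.exp (-(π / 4 * I)) * Complex.exp (I * (phase (2 * π) t : ℝ))) by ring,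
      norm_mul, norm_mul, norm_natCast_cpow_neg_I_mul hk, mul_one, Complex.norm_real,
      Real.norm_eq_abs]
    calc _ ≤ 1 * (38 / t) := by
          gcongr
          · exact hw1 t ht'
          · exact norm_inv_chi_sub_le (hT.trans ht'.1)
      _ ≤ 38 / T := by
          rw [one_mul]
          have := ht.1
          gcongr
  · rw [show 2 * T - T = T by ring, abs_of_pos (by linarith)]
    exact (div_mul_cancel₀ _ (by linarith : T ≠ 0)).le

lemma norm_exp_neg_pi_div_four : ‖Complex.exp (-(π / 4 * I))‖ = 1 := by
  rw [show (-(π / 4 * I) : ℂ) = I * ((-(π / 4) : ℝ) : ℂ) by push_cast; ring, norm_exp_I_mul]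

lemma norm_endpointWeight_le (T : ℝ) (k : ℕ) : ‖endpointWeight T k‖ ≤ 1 := by
  unfold endpointWeight
  split_ifs <;> norm_num

lemma endpointWeight_eq_zero {T : ℝ} {k : ℕ}
    (h : 2 * π * k < T ∨ 2 * T < 2 * π * k) : endpointWeight T k = 0 := by
  refine if_neg fun ⟨h1, h2⟩ => ?_
  rw [div_le_iff₀ (by positivity)] at h1
  rw [le_div_iff₀ Real.pi_pos] at h2
  rcases h with h | h <;> linarith

lemma endpointWeight_eq_one {T : ℝ} {k : ℕ} (h1 : T < 2 * π * k) (h2 : 2 * π * k < 2 * T) :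
    endpointWeight T k = 1 := by
  have e1 : T / (2 * π) < k := by
    rw [div_lt_iff₀ (by positivity)]
    linarith
  have e2 : (k : ℝ) < T / π := by
    rw [lt_div_iff₀ Real.pi_pos]
    linarith
  rw [endpointWeight, if_pos ⟨e1.le, e2.le⟩, if_neg]
  rintro (h | h)
  · exact e1.ne' h
  · exact e2.ne h

theorem exists_norm_weightedIntegral_sub_le {ρ : ℝ → ℝ}
    (hρ_smooth : ContDiffOn ℝ (⊤ : ℕ∞) ρ (Set.Ioi 0))
    (hρ_nonneg : ∀ u : ℝ, 0 < u → 0 ≤ ρ u)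
    (hρ_fe : ∀ u : ℝ, 0 < u → ρ u + ρ (1 / u) = 1)
    (hρ_supp : ∀ u : ℝ, 2 ≤ u → ρ u = 0) :
    ∃ C, 0 ≤ C ∧ ∀ q T : ℝ, 10 ≤ q → T = q ^ 4 → ∀ k : ℕ, k ≠ 0 →
      ‖((√k)⁻¹ : ℝ) * weightedIntegral ρ T k - 2 * π * endpointWeight T k‖ ≤
        C * (√k)⁻¹ + (if 2 * π * k ≤ 4 * T then C * q * (√k)⁻¹ else 0) +
          if |2 * π * k - T| < q ^ 3 ∨ |2 * π * k - 2 * T| < q ^ 3 then C else 0 := by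
  obtain ⟨M, hM0, hM⟩ := exists_smoothWeight_deriv_le hρ_smooth hρ_fe hρ_supp
  refine ⟨4 * (4 + M) + 2080000 + 2400000 + 8, by positivity, fun q T hq hT k hk => ?_⟩
  set C := 4 * (4 + M) + 2080000 + 2400000 + 8 with hC
  have hk0 : (0 : ℝ) < k := by exact_mod_cast Nat.pos_of_ne_zero hk
  have hk1 : (1 : ℝ) ≤ k := by exact_mod_cast Nat.pos_of_ne_zero hk
  have hq3 : 0 < q ^ 3 := by positivity
  have hT10 : 10 * q ^ 3 ≤ T := by
    rw [hT, show q ^ 4 = q * q ^ 3 by ring]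
    gcongr
  have hT400 : 400 ≤ T := by
    have : (10 : ℝ) ^ 3 ≤ q ^ 3 := by gcongr
    linarith
  have hT0 : 0 < T := by linarith
  obtain ⟨w', hw'c, hw'⟩ := hM k hk0
  have hpos : ∀ t ∈ Set.Icc T (2 * T), 0 < t := fun t ht => hT0.trans_le ht.1
  have hwc : ContinuousOn (smoothWeight ρ k) (Set.Icc T (2 * T)) := fun t ht =>
    (hw' t (hpos t ht)).1.continuousAt.continuousWithinAt
  have hw1 : ∀ t ∈ Set.Icc T (2 * T), |smoothWeight ρ k t| ≤ 1 := fun t ht =>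
    smoothWeight_abs_le_one hρ_nonneg hρ_fe hk0 (hpos t ht)
  have hJ := norm_weightedIntegral_sub_le (by linarith) hk hwc hw1
  set P := ∫ t in T..(2 * T), (smoothWeight ρ k t : ℂ) *
    Complex.exp (I * (phase (2 * π * k) t : ℝ)) with hP
  set κ := 2 * π * (k : ℝ) with hκ
  have hκ6 : 6 * k ≤ κ := by nlinarith [Real.pi_gt_three]
  have hκ8 : κ ≤ 8 * k := by nlinarith [Real.pi_lt_four]
  have hκ0 : 0 < κ := by positivity
  have hfar : ∀ l, 0 < l → (κ ≤ T * (1 - l) ∨ 2 * T ≤ κ * (1 - l)) → ‖P‖ ≤ (4 + M) / l :=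
    fun l hl h => norm_integral_mul_exp_phase_le hκ0 hT0 (by linarith) le_rfl hl hM0
      (fun t ht => (hw' t (hpos t ht)).1) (hw'c.mono hpos) hw1
      (fun t ht => (hw' t (hpos t ht)).2) fun t ht => le_abs_log_div hT0 hκ0 ht h
  have hone : κ ≤ 4 * T → P = ∫ t in T..(2 * T), Complex.exp (I * (phase κ t : ℝ)) := fun h => by
    refine intervalIntegral.integral_congr fun t ht => ?_
    rw [Set.uIcc_of_le (by linarith)] at ht
    rw [smoothWeight_eq_one hρ_fe hρ_supp hk0 (hT400.trans ht.1) (by linarith [ht.1]),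
      Complex.ofReal_one, one_mul]
  set s := (√(k : ℝ))⁻¹ with hs
  have hs0 : 0 < s := by positivity
  set e := Complex.exp (-(π / 4 * I)) with he
  have hen : ‖e‖ = 1 := norm_exp_neg_pi_div_four
  set J := weightedIntegral ρ T k
  set m := endpointWeight T k with hm
  have hred : ‖(s : ℂ) * J - 2 * π * m‖ ≤ 38 * s + ‖(s : ℂ) * (e * P) - 2 * π * m‖ := by
    rw [show (s : ℂ) * J - 2 * π * m = s * (J - e * P) + (s * (e * P) - 2 * π * m) by ring]
    refine (norm_add_le _ _).trans ?_
    rw [norm_mul, Complex.norm_real, Real.norm_of_nonneg hs0.le, mul_comm]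
    gcongr
  have hPn : ‖(s : ℂ) * (e * P)‖ = s * ‖P‖ := by
    rw [norm_mul, norm_mul, hen, one_mul, Complex.norm_real, Real.norm_of_nonneg hs0.le]
  refine hred.trans ?_
  have hC38 : 38 ≤ C := by linarith
  have hite : 0 ≤ if |κ - T| < q ^ 3 ∨ |κ - 2 * T| < q ^ 3 then C else 0 := by
    split_ifs <;> linarith
  have hs38 : 38 * s ≤ C * s := by gcongr
  have hqC : 4 * (4 + M) * q * s ≤ C * q * s := by
    gcongr
    linarith
  rcases lt_or_ge (4 * T) κ with hbig | hsmall
  · rw [if_neg (not_le.mpr hbig), if_neg]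
    · rw [hm, endpointWeight_eq_zero (Or.inr (by linarith)), mul_zero, sub_zero, hPn]
      have := hfar (1 / 2) (by norm_num) (Or.inr (by linarith))
      have : s * ‖P‖ ≤ s * ((4 + M) / (1 / 2)) := by gcongr
      nlinarith
    · rw [abs_of_pos (by linarith), abs_of_pos (by linarith)]
      push Not
      constructor <;> linarith
  rw [if_pos hsmall]
  by_cases hnear : |κ - T| < q ^ 3 ∨ |κ - 2 * T| < q ^ 3
  · rw [if_pos hnear]
    have hlow : T ≤ 2 * κ := by
      rcases hnear with h | h <;> linarith [(abs_lt.mp h).1]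
    have hPb : ‖P‖ ≤ 800000 * √κ := by
      rw [hone hsmall]
      exact norm_integral_exp_phase_dyadic_le (by linarith) hlow hsmall
    have hsq : √κ ≤ 3 * √k := by
      rw [show (3 : ℝ) = √9 by rw [show (9 : ℝ) = 3 ^ 2 by norm_num]; simp,
        ← Real.sqrt_mul (by norm_num)]
      exact Real.sqrt_le_sqrt (by linarith)
    have h1 : s * ‖P‖ ≤ 2400000 := by
      calc s * ‖P‖ ≤ s * (800000 * (3 * √k)) := by gcongr; linarith
        _ = 2400000 * (s * √k) := by ring
        _ = _ := by rw [hs, inv_mul_cancel₀ (by positivity), mul_one]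
    have h2 : ‖2 * π * m‖ ≤ 8 := by
      rw [norm_mul, norm_mul, Complex.norm_real, Real.norm_of_nonneg Real.pi_pos.le]
      have := norm_endpointWeight_le T k
      rw [← hm] at this
      calc _ ≤ 2 * 4 * (1 : ℝ) := by
            gcongr
            · norm_num
            · exact Real.pi_lt_four.le
        _ = 8 := by norm_num
    have h3 : 0 ≤ C * q * s := by positivity
    have := norm_sub_le ((s : ℂ) * (e * P)) (2 * π * m)
    rw [hPn] at this
    linarith
  · rw [if_neg hnear, add_zero]
    push Not at hnear
    obtain ⟨n1, n2⟩ := hnear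
    by_cases hmid : T < κ ∧ κ < 2 * T
    · rw [abs_of_pos (by linarith)] at n1
      rw [abs_of_neg (by linarith)] at n2
      rw [hm, endpointWeight_eq_one hmid.1 hmid.2, hone hsmall]
      have hb := norm_integral_exp_phase_dyadic_sub_le (by linarith) hT
        (by linarith : T + q ^ 3 ≤ κ) (by linarith)
      have hmain := integral_exp_main_term hk
      rw [← hκ, ← he] at hmain
      set Q := ∫ t in T..(2 * T), Complex.exp (I * (phase κ t : ℝ))
      set R := 2 * (κ : ℂ) * Complex.exp (-(I * κ)) * halfFresnel κ
      have e1 : (s : ℂ) * (e * Q) - 2 * π * 1 = s * e * (Q - R) := by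
        rw [mul_sub, mul_assoc _ _ R, hmain]
        have : (s : ℂ) * (√(k : ℝ) : ℝ) = 1 := by
          rw [← Complex.ofReal_mul, hs, inv_mul_cancel₀ (by positivity), Complex.ofReal_one]
        push_cast
        linear_combination (2 * π : ℂ) * this
      rw [e1, norm_mul, norm_mul, hen, mul_one, Complex.norm_real, Real.norm_of_nonneg hs0.le]
      have h1 : s * ‖Q - R‖ ≤ s * (2080000 * q) := by gcongr
      have h2 : 2080000 * q * s ≤ C * q * s := by
        gcongr
        linarith
      linarith
    · have hl : (0 : ℝ) < 1 / (4 * q) := by positivity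
      have hTl : T * (1 / (4 * q)) = q ^ 3 / 4 := by
        rw [hT]
        field_simp
      have hcase : κ ≤ T - q ^ 3 ∨ 2 * T + q ^ 3 ≤ κ := by
        rcases le_or_gt κ T with h | h
        · rw [abs_of_nonpos (by linarith)] at n1
          left
          linarith
        · have h2 : 2 * T ≤ κ := by
            by_contra! h3
            exact hmid ⟨h, h3⟩
          rw [abs_of_nonneg (by linarith)] at n2
          right
          linarith
      have hm0 : m = 0 := endpointWeight_eq_zero
        (hcase.imp (fun h => by linarith) fun h => by linarith)
      have hPb := hfar _ hl (hcase.imp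
        (fun h => by rw [mul_sub, hTl]; linarith)
        (fun h => by
          have : κ * (1 / (4 * q)) ≤ 4 * T * (1 / (4 * q)) := by gcongr
          rw [mul_sub]
          linarith))
      rw [hm0, mul_zero, sub_zero, hPn]
      have h1 : s * ‖P‖ ≤ s * ((4 + M) / (1 / (4 * q))) := by gcongr
      have h2 : s * ((4 + M) / (1 / (4 * q))) = 4 * (4 + M) * q * s := by
        field_simp
      linarith

lemma weightedIntegral_eq_zero {ρ : ℝ → ℝ} (hρ_supp : ∀ u : ℝ, 2 ≤ u → ρ u = 0) {T : ℝ}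
    (hT : 0 < T) {k : ℕ} (hk : T ^ ((3 : ℝ) / 2) ≤ k) : weightedIntegral ρ T k = 0 := by
  rw [weightedIntegral, intervalIntegral.integral_congr (g := fun _ => 0),
    intervalIntegral.integral_zero]
  intro t ht
  rw [Set.uIcc_of_le (by linarith)] at ht
  simp [smoothWeight_eq_zero hρ_supp hT ht hk]

lemma sum_inv_Icc_le (N : ℕ) : ∑ a ∈ Icc 1 N, ((a : ℝ))⁻¹ ≤ 1 + Real.log N := by
  have := harmonic_le_one_add_log N
  rw [harmonic_eq_sum_Icc] at this
  push_cast at this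
  exact this

lemma sum_inv_sqrt_Icc_le (n : ℕ) : ∑ c ∈ Icc 1 n, (√(c : ℝ))⁻¹ ≤ 2 * √n := by
  induction n with
  | zero => simp
  | succ n ih =>
    rw [sum_Icc_succ_top (by omega)]
    refine (add_le_add_left ih _).trans ?_
    have h1 : √((n + 1 : ℕ) : ℝ) ^ 2 = n + 1 := by
      rw [Real.sq_sqrt (by positivity)]
      push_cast
      ring
    have h2 : √(n : ℝ) ^ 2 = n := Real.sq_sqrt (by positivity)
    have h3 : 0 < √((n + 1 : ℕ) : ℝ) := Real.sqrt_pos.mpr (by positivity)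
    rw [← sub_nonneg]
    have : 2 * √((n + 1 : ℕ) : ℝ) - (2 * √(n : ℝ) + (√((n + 1 : ℕ) : ℝ))⁻¹) =
        (√((n + 1 : ℕ) : ℝ) - √n) ^ 2 * (√((n + 1 : ℕ) : ℝ))⁻¹ := by
      field_simp
      nlinarith
    rw [this]
    positivity

lemma sum_d3_mul {N : ℕ} {S : Finset ℕ} (hS : S ⊆ Icc 1 N) (f : ℕ → ℝ) :
    ∑ k ∈ S, (d3 k : ℝ) * f k = ∑ a ∈ Icc 1 N, ∑ b ∈ Icc 1 N, ∑ c ∈ Icc 1 N,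
      if a * b * c ∈ S then f (a * b * c) else 0 := by
  have h1 : ∀ k ∈ S, (d3 k : ℝ) * f k = ∑ p ∈ Icc 1 N ×ˢ Icc 1 N ×ˢ Icc 1 N,
      if p.1 * p.2.1 * p.2.2 = k then f k else 0 := fun k hk => by
    have hkN := mem_Icc.mp (hS hk)
    rw [← sum_filter, sum_const, nsmul_eq_mul, d3]
    congr 3
    ext ⟨a, b, c⟩
    simp only [mem_filter, mem_product, mem_Icc]
    constructor
    · rintro ⟨⟨⟨h1, h2⟩, ⟨h3, h4⟩, h5, h6⟩, h⟩
      exact ⟨⟨⟨h1, by omega⟩, ⟨h3, by omega⟩, h5, by omega⟩, h⟩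
    · rintro ⟨⟨⟨h1, h2⟩, ⟨h3, h4⟩, h5, h6⟩, h⟩
      have hk0 : k ≠ 0 := by omega
      refine ⟨⟨⟨h1, ?_⟩, ⟨h3, ?_⟩, h5, ?_⟩, h⟩ <;>
        refine Nat.le_of_dvd (by omega) (h ▸ ?_)
      · exact (dvd_mul_right a b).mul_right c
      · exact (dvd_mul_left b a).mul_right c
      · exact dvd_mul_left c (a * b)
  rw [sum_congr rfl h1, sum_comm, sum_product]
  simp only [sum_product, sum_ite_eq]

theorem sum_d3_mul_inv_sqrt_le (N : ℕ) :
    ∑ k ∈ Icc 1 N, (d3 k : ℝ) * (√(k : ℝ))⁻¹ ≤ 2 * √N * (1 + Real.log N) ^ 2 := by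
  rw [sum_d3_mul Subset.rfl]
  have hinner : ∀ a ∈ Icc 1 N, ∀ b ∈ Icc 1 N, (∑ c ∈ Icc 1 N,
      if a * b * c ∈ Icc 1 N then (√((a * b * c : ℕ) : ℝ))⁻¹ else 0) ≤
        2 * √N * ((a : ℝ)⁻¹ * (b : ℝ)⁻¹) := fun a ha b hb => by
    have ha1 := (mem_Icc.mp ha).1
    have hb1 := (mem_Icc.mp hb).1
    have hab : 0 < a * b := by positivity
    have habR : (0 : ℝ) < a * b := by exact_mod_cast hab
    rw [← sum_filter]
    have hsub : (Icc 1 N).filter (fun c => a * b * c ∈ Icc 1 N) ⊆ Icc 1 (N / (a * b)) := by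
      intro c hc
      simp only [mem_filter, mem_Icc] at hc ⊢
      exact ⟨hc.1.1, (Nat.le_div_iff_mul_le hab).mpr (by rw [mul_comm]; exact hc.2.2)⟩
    have hq : √((N / (a * b) : ℕ) : ℝ) ≤ √N / √(a * b : ℝ) := by
      rw [← Real.sqrt_div (by positivity)]
      refine Real.sqrt_le_sqrt ?_
      exact_mod_cast (Nat.cast_div_le (α := ℝ) (m := N) (n := a * b))
    calc _ ≤ ∑ c ∈ Icc 1 (N / (a * b)), (√((a * b * c : ℕ) : ℝ))⁻¹ :=
          sum_le_sum_of_subset_of_nonneg hsub fun _ _ _ => by positivity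
      _ = (√(a * b : ℝ))⁻¹ * ∑ c ∈ Icc 1 (N / (a * b)), (√(c : ℝ))⁻¹ := by
          rw [mul_sum]
          refine sum_congr rfl fun c _ => ?_
          rw [Nat.cast_mul, Nat.cast_mul, Real.sqrt_mul habR.le, mul_inv]
      _ ≤ (√(a * b : ℝ))⁻¹ * (2 * (√N / √(a * b : ℝ))) := by
          gcongr
          exact (sum_inv_sqrt_Icc_le _).trans (by gcongr)
      _ = 2 * √N * (√(a * b : ℝ) * √(a * b : ℝ))⁻¹ := by
          rw [mul_inv]
          ring
      _ = _ := by rw [Real.mul_self_sqrt habR.le, mul_inv]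
  calc _ ≤ ∑ a ∈ Icc 1 N, ∑ b ∈ Icc 1 N, 2 * √N * ((a : ℝ)⁻¹ * (b : ℝ)⁻¹) :=
        sum_le_sum fun a ha => sum_le_sum fun b hb => hinner a ha b hb
    _ = 2 * √N * (∑ a ∈ Icc 1 N, (a : ℝ)⁻¹) ^ 2 := by
        rw [sq, sum_mul_sum, mul_sum]
        simp only [mul_sum]
    _ ≤ _ := by
        gcongr
        exact sum_inv_Icc_le N

/-- A bound for the sum of `d3` over a sparse set, by fixing the two smallest of three factors. -/
theorem sum_d3_le_of_card_multiples_le {N : ℕ} {S : Finset ℕ} (hS : S ⊆ Icc 1 N) {H Y : ℝ}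
    (hH : 0 ≤ H) (hY : 0 ≤ Y) (hNY : (N : ℝ) ^ 2 ≤ Y ^ 3)
    (hc : ∀ m : ℕ, 0 < m → (((Icc 1 N).filter fun c => m * c ∈ S).card : ℝ) ≤ H / m + 1) :
    ∑ k ∈ S, (d3 k : ℝ) ≤ 3 * (H + Y) * (1 + Real.log N) ^ 2 := by
  set B := Icc 1 N ×ˢ Icc 1 N ×ˢ Icc 1 N with hB
  set E := B.filter fun p => p.1 * p.2.1 * p.2.2 ∈ S with hE
  set F := E.filter fun p => (p.1 * p.2.1) ^ 3 ≤ N ^ 2 with hF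
  have hcard : ∑ k ∈ S, (d3 k : ℝ) = E.card := by
    have := sum_d3_mul hS fun _ => 1
    simp only [mul_one] at this
    rw [this, hE, card_filter, hB, sum_product]
    simp only [sum_product]
    push_cast
    rfl
  have hEF : E.card ≤ 3 * F.card := by
    have hsub : E ⊆ F ∪ F.image (fun p => (p.2.2, p.2.1, p.1)) ∪
        F.image (fun p => (p.1, p.2.2, p.2.1)) := by
      rintro ⟨a, b, c⟩ h
      have hpow : ∀ x y z : ℕ, x ≤ z → y ≤ z → x * y * z ≤ N → (x * y) ^ 3 ≤ N ^ 2 :=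
        fun x y z hx hy hN => by
          calc (x * y) ^ 3 = (x * y) ^ 2 * (x * y) := by ring
            _ ≤ (x * y) ^ 2 * (z * z) := by gcongr
            _ = (x * y * z) ^ 2 := by ring
            _ ≤ N ^ 2 := by gcongr
      simp only [hE, hB, mem_filter, mem_product] at h
      obtain ⟨⟨ha, hb, hc'⟩, habc⟩ := h
      have hN := (mem_Icc.mp (hS habc)).2
      simp only [mem_union, mem_image, hF, hE, hB, mem_filter, mem_product]
      rcases le_total a b with h1 | h1 <;> rcases le_total b c with h2 | h2
      · exact Or.inl (Or.inl ⟨⟨⟨ha, hb, hc'⟩, habc⟩, hpow a b c (h1.trans h2) h2 hN⟩)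
      · refine Or.inr ⟨(a, c, b), ⟨⟨⟨ha, hc', hb⟩, ?_⟩, ?_⟩, rfl⟩
        · rwa [mul_right_comm]
        · exact hpow a c b h1 h2 (by rwa [mul_right_comm])
      · rcases le_total a c with h3 | h3
        · exact Or.inl (Or.inl ⟨⟨⟨ha, hb, hc'⟩, habc⟩, hpow a b c h3 h2 hN⟩)
        · refine Or.inl (Or.inr ⟨(c, b, a), ⟨⟨⟨hc', hb, ha⟩, ?_⟩, ?_⟩, rfl⟩)
          · rwa [show c * b * a = a * b * c by ring]
          · exact hpow c b a h3 h1 (by rwa [show c * b * a = a * b * c by ring])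
      · refine Or.inl (Or.inr ⟨(c, b, a), ⟨⟨⟨hc', hb, ha⟩, ?_⟩, ?_⟩, rfl⟩)
        · rwa [show c * b * a = a * b * c by ring]
        · exact hpow c b a (h2.trans h1) h1 (by rwa [show c * b * a = a * b * c by ring])
    have h1 := card_le_card hsub
    have h2 := card_union_le (F ∪ F.image (fun p => (p.2.2, p.2.1, p.1)))
      (F.image (fun p => (p.1, p.2.2, p.2.1)))
    have h3 := card_union_le F (F.image (fun p => (p.2.2, p.2.1, p.1)))
    have h4 : (F.image (fun p => (p.2.2, p.2.1, p.1))).card ≤ F.card := card_image_le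
    have h5 : (F.image (fun p => (p.1, p.2.2, p.2.1))).card ≤ F.card := card_image_le
    omega
  have hFc : (F.card : ℝ) ≤ (H + Y) * (1 + Real.log N) ^ 2 := by
    have h1 : (F.card : ℝ) = ∑ a ∈ Icc 1 N, ∑ b ∈ Icc 1 N,
        (((Icc 1 N).filter fun c => a * b * c ∈ S ∧ (a * b) ^ 3 ≤ N ^ 2).card : ℝ) := by
      rw [hF, hE, filter_filter, card_filter, hB, sum_product]
      simp only [sum_product, card_filter]
      push_cast
      rfl
    have h2 : ∀ a ∈ Icc 1 N, ∀ b ∈ Icc 1 N,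
        (((Icc 1 N).filter fun c => a * b * c ∈ S ∧ (a * b) ^ 3 ≤ N ^ 2).card : ℝ) ≤
          (H + Y) * ((a : ℝ)⁻¹ * (b : ℝ)⁻¹) := fun a ha b hb => by
      have ha1 := (mem_Icc.mp ha).1
      have hb1 := (mem_Icc.mp hb).1
      have hab : 0 < a * b := by positivity
      have habR : (0 : ℝ) < a * b := by exact_mod_cast hab
      by_cases h : (a * b) ^ 3 ≤ N ^ 2
      · simp only [h, and_true]
        have h3 : ((a * b : ℕ) : ℝ) ^ 3 ≤ Y ^ 3 := le_trans (by exact_mod_cast h) hNY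
        have h4 : (a * b : ℝ) ≤ Y := by
          have := le_of_pow_le_pow_left₀ (by norm_num) hY h3
          exact_mod_cast this
        calc _ ≤ H / ((a * b : ℕ) : ℝ) + 1 := hc _ hab
          _ ≤ H / (a * b) + Y / (a * b) := by
            push_cast
            gcongr
            rwa [one_le_div habR]
          _ = _ := by
            field_simp
      · simp only [h, and_false, filter_false, card_empty, Nat.cast_zero]
        positivity
    rw [h1]
    calc _ ≤ ∑ a ∈ Icc 1 N, ∑ b ∈ Icc 1 N, (H + Y) * ((a : ℝ)⁻¹ * (b : ℝ)⁻¹) :=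
          sum_le_sum fun a ha => sum_le_sum fun b hb => h2 a ha b hb
      _ = (H + Y) * (∑ a ∈ Icc 1 N, (a : ℝ)⁻¹) ^ 2 := by
          rw [sq, sum_mul_sum, mul_sum]
          simp only [mul_sum]
      _ ≤ _ := by
          gcongr
          exact sum_inv_Icc_le N
  rw [hcard]
  have : (E.card : ℝ) ≤ 3 * F.card := by exact_mod_cast hEF
  linarith

lemma card_le_of_forall_sub_le {A : Finset ℕ} {L : ℝ} (hL : 0 ≤ L)
    (h : ∀ x ∈ A, ∀ y ∈ A, (x : ℝ) - y ≤ L) : (A.card : ℝ) ≤ L + 1 := by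
  rcases A.eq_empty_or_nonempty with rfl | hA
  · simp only [card_empty, Nat.cast_zero]
    positivity
  · have hsub : A ⊆ Icc (A.min' hA) (A.max' hA) := fun x hx =>
      mem_Icc.mpr ⟨A.min'_le x hx, A.le_max' x hx⟩
    have h1 := card_le_card hsub
    rw [Nat.card_Icc] at h1
    have h2 := h _ (A.max'_mem hA) _ (A.min'_mem hA)
    have h3 : A.min' hA ≤ A.max' hA := A.min'_le _ (A.max'_mem hA)
    have h4 : A.card + A.min' hA ≤ A.max' hA + 1 := by omega
    have h5 : (A.card : ℝ) + A.min' hA ≤ A.max' hA + 1 := by exact_mod_cast h4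
    linarith

lemma sum_d3_abs_sub_lt_le {N : ℕ} {X D : ℝ} (hD : 0 ≤ D) (hND : (N : ℝ) ^ 2 ≤ D ^ 3) :
    ∑ k ∈ (Icc 1 N).filter (fun k : ℕ => |2 * π * k - X| < D), (d3 k : ℝ) ≤
      6 * D * (1 + Real.log N) ^ 2 := by
  refine (sum_d3_le_of_card_multiples_le (filter_subset _ _) hD hD hND fun m hm => ?_).trans_eq
    (by ring)
  have hm0 : (0 : ℝ) < m := by exact_mod_cast hm
  refine card_le_of_forall_sub_le (by positivity) fun x hx y hy => ?_
  have h1 := abs_lt.mp (mem_filter.mp (mem_filter.mp hx).2).2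
  have h2 := abs_lt.mp (mem_filter.mp (mem_filter.mp hy).2).2
  push_cast at h1 h2
  rw [le_div_iff₀ hm0]
  have h3 : π * (((x : ℝ) - y) * m) ≤ D := by linarith [h1.2, h2.1]
  by_contra! h4
  nlinarith [Real.pi_gt_three]

lemma psum_eq_sum_endpointWeight {T : ℝ} {N : ℕ} (hT : 0 < T) (hN : T ≤ N) (f : ℕ → ℂ) :
    psum (T / (2 * π)) (T / π) f = ∑ k ∈ Icc 1 N, endpointWeight T k * f k := by
  have hcond : ∀ k : ℕ, k ∈ Icc ⌈T / (2 * π)⌉₊ ⌊T / π⌋₊ ↔ T / (2 * π) ≤ k ∧ (k : ℝ) ≤ T / π :=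
    fun k => by rw [mem_Icc, Nat.ceil_le, Nat.le_floor_iff (by positivity)]
  rw [psum]
  have h1 : ∀ k ∈ Icc ⌈T / (2 * π)⌉₊ ⌊T / π⌋₊,
      (if (k : ℝ) = T / (2 * π) ∨ (k : ℝ) = T / π then (1 / 2 : ℂ) else 1) * f k =
        endpointWeight T k * f k := fun k hk => by
    rw [endpointWeight, if_pos ((hcond k).mp hk)]
  rw [sum_congr rfl h1]
  refine sum_subset (fun k hk => ?_) fun k _ hk => ?_
  · obtain ⟨h2, h3⟩ := (hcond k).mp hk
    have h4 : (0 : ℝ) < k := lt_of_lt_of_le (by positivity) h2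
    have h5 : (k : ℝ) ≤ N := by
      refine (h3.trans ?_).trans hN
      exact div_le_self hT.le (by linarith [Real.pi_gt_three])
    exact mem_Icc.mpr ⟨by exact_mod_cast h4, by exact_mod_cast h5⟩
  · rw [endpointWeight, if_neg fun h => hk ((hcond k).mpr h), zero_mul]

lemma tsum_weightedIntegral_eq_sum {ρ : ℝ → ℝ} (hρ_supp : ∀ u : ℝ, 2 ≤ u → ρ u = 0) {T : ℝ}
    (hT : 0 < T) {N : ℕ} (hN : T ^ ((3 : ℝ) / 2) ≤ N + 1) :
    ∑' k : ℕ, (((d3 k : ℝ) * (k : ℝ) ^ (-(1 : ℝ) / 2) : ℝ) : ℂ) * weightedIntegral ρ T k =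
      ∑ k ∈ Icc 1 N, (d3 k : ℂ) * ((((√(k : ℝ))⁻¹ : ℝ) : ℂ) * weightedIntegral ρ T k) := by
  rw [tsum_eq_sum (s := Icc 1 N)]
  · refine sum_congr rfl fun k _ => ?_
    rw [neg_div, Real.rpow_neg (by positivity), ← Real.sqrt_eq_rpow]
    push_cast
    ring
  · intro k hk
    rcases Nat.eq_zero_or_pos k with rfl | hk0
    · simp [d3]
    · have h1 : N + 1 ≤ k := by
        by_contra! h
        exact hk (mem_Icc.mpr ⟨hk0, by omega⟩)
      have h2 : (N : ℝ) + 1 ≤ k := by exact_mod_cast h1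
      rw [weightedIntegral_eq_zero hρ_supp hT (hN.trans h2), mul_zero]

lemma sum_d3_mul_error_le {C q T L : ℝ} {N N₁ : ℕ} (hC : 0 ≤ C) (hq : 1 ≤ q) (hT : T = q ^ 4)
    (hN : (N : ℝ) ≤ q ^ 6) (hN₁ : (N₁ : ℝ) ≤ T) (hN₁' : T ≤ N₁ + 1)
    (hL : 1 + Real.log N ≤ L) (hL₁ : 1 + Real.log N₁ ≤ L) :
    ∑ k ∈ Icc 1 N, (d3 k : ℝ) * (C * (√(k : ℝ))⁻¹ +
      (if 2 * π * k ≤ 4 * T then C * q * (√(k : ℝ))⁻¹ else 0) +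
        if |2 * π * k - T| < q ^ 3 ∨ |2 * π * k - 2 * T| < q ^ 3 then C else 0) ≤
      16 * C * q ^ 3 * L ^ 2 := by
  have hq3 : 0 < q ^ 3 := by positivity
  have hTq : q ^ 3 ≤ T := by
    rw [hT]
    exact pow_le_pow_right₀ hq (by norm_num)
  have hsq : ∀ M : ℕ, ∀ y : ℝ, 0 ≤ y → (M : ℝ) ≤ y ^ 2 → 1 + Real.log M ≤ L →
      ∑ k ∈ Icc 1 M, (d3 k : ℝ) * (√(k : ℝ))⁻¹ ≤ 2 * y * L ^ 2 := fun M y hy hM hML => by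
    refine (sum_d3_mul_inv_sqrt_le M).trans ?_
    have := Real.log_natCast_nonneg M
    gcongr
    exact Real.sqrt_le_iff.mpr ⟨hy, hM⟩
  have hND : (N₁ : ℝ) ^ 2 ≤ (q ^ 3) ^ 3 := by
    calc (N₁ : ℝ) ^ 2 ≤ T ^ 2 := by gcongr
      _ = q ^ 8 := by rw [hT]; ring
      _ ≤ q ^ 9 := pow_le_pow_right₀ hq (by norm_num)
      _ = _ := by ring
  have hnear : ∀ X : ℝ, ∑ k ∈ (Icc 1 N₁).filter (fun k : ℕ => |2 * π * k - X| < q ^ 3),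
      (d3 k : ℝ) ≤ 6 * q ^ 3 * L ^ 2 := fun X => by
    refine (sum_d3_abs_sub_lt_le hq3.le hND).trans ?_
    have := Real.log_natCast_nonneg N₁
    gcongr
  have hmem : ∀ k : ℕ, k ∈ Icc 1 N → 2 * π * k ≤ 4 * T → k ∈ Icc 1 N₁ := fun k hk h => by
    have hk1 := (mem_Icc.mp hk).1
    have hk0 : (0 : ℝ) < k := by exact_mod_cast hk1
    refine mem_Icc.mpr ⟨hk1, ?_⟩
    have : (k : ℝ) < N₁ + 1 := by nlinarith [Real.pi_gt_three]
    exact Nat.lt_succ_iff.mp (by exact_mod_cast this)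
  have s1 : ∑ k ∈ Icc 1 N, (d3 k : ℝ) * (C * (√(k : ℝ))⁻¹) ≤ 2 * C * q ^ 3 * L ^ 2 := by
    have := hsq N (q ^ 3) hq3.le (by linarith [show (q ^ 3) ^ 2 = q ^ 6 by ring]) hL
    calc _ = C * ∑ k ∈ Icc 1 N, (d3 k : ℝ) * (√(k : ℝ))⁻¹ := by
          rw [mul_sum]
          exact sum_congr rfl fun k _ => by ring
      _ ≤ C * (2 * q ^ 3 * L ^ 2) := by gcongr
      _ = _ := by ring
  have s2 : ∑ k ∈ Icc 1 N, (d3 k : ℝ) *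
      (if 2 * π * k ≤ 4 * T then C * q * (√(k : ℝ))⁻¹ else 0) ≤ 2 * C * q ^ 3 * L ^ 2 := by
    have := hsq N₁ (q ^ 2) (by positivity) (by linarith [show (q ^ 2) ^ 2 = q ^ 4 by ring]) hL₁
    simp only [mul_ite, mul_zero]
    rw [← sum_filter]
    calc _ ≤ ∑ k ∈ Icc 1 N₁, (d3 k : ℝ) * (C * q * (√(k : ℝ))⁻¹) :=
          sum_le_sum_of_subset_of_nonneg
            (fun k hk => hmem k (mem_filter.mp hk).1 (mem_filter.mp hk).2)
            fun _ _ _ => by positivity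
      _ = C * q * ∑ k ∈ Icc 1 N₁, (d3 k : ℝ) * (√(k : ℝ))⁻¹ := by
          rw [mul_sum]
          exact sum_congr rfl fun k _ => by ring
      _ ≤ C * q * (2 * q ^ 2 * L ^ 2) := by gcongr
      _ = _ := by ring
  have s3 : ∑ k ∈ Icc 1 N, (d3 k : ℝ) *
      (if |2 * π * k - T| < q ^ 3 ∨ |2 * π * k - 2 * T| < q ^ 3 then C else 0) ≤
        12 * C * q ^ 3 * L ^ 2 := by
    simp only [mul_ite, mul_zero]
    rw [← sum_filter, ← sum_mul, filter_or]
    have hsub : ∀ X : ℝ, X ≤ 2 * T → (Icc 1 N).filter (fun k : ℕ => |2 * π * k - X| < q ^ 3) ⊆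
        (Icc 1 N₁).filter (fun k : ℕ => |2 * π * k - X| < q ^ 3) := fun X hX k hk => by
      obtain ⟨h1, h2⟩ := mem_filter.mp hk
      exact mem_filter.mpr ⟨hmem k h1 (by linarith [(abs_lt.mp h2).2]), h2⟩
    have h1 : ∀ X : ℝ, X ≤ 2 * T →
        ∑ k ∈ (Icc 1 N).filter (fun k : ℕ => |2 * π * k - X| < q ^ 3), (d3 k : ℝ) ≤
          6 * q ^ 3 * L ^ 2 := fun X hX =>
      (sum_le_sum_of_subset_of_nonneg (hsub X hX) fun _ _ _ => by positivity).trans (hnear X)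
    have h2 := sum_union_inter (f := fun k => (d3 k : ℝ))
      (s₁ := (Icc 1 N).filter (fun k : ℕ => |2 * π * k - T| < q ^ 3))
      (s₂ := (Icc 1 N).filter (fun k : ℕ => |2 * π * k - 2 * T| < q ^ 3))
    have h3 : 0 ≤ ∑ k ∈ (Icc 1 N).filter (fun k : ℕ => |2 * π * k - T| < q ^ 3) ∩
        (Icc 1 N).filter (fun k : ℕ => |2 * π * k - 2 * T| < q ^ 3), (d3 k : ℝ) :=
      sum_nonneg fun _ _ => by positivity
    calc _ ≤ (6 * q ^ 3 * L ^ 2 + 6 * q ^ 3 * L ^ 2) * C := by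
          gcongr
          linarith [h1 T (by linarith), h1 (2 * T) le_rfl]
      _ = _ := by ring
  simp only [mul_add, sum_add_distrib] at s1 s2 s3 ⊢
  linarith

theorem stmt16 (ρ : ℝ → ℝ) (hρ_smooth : ContDiffOn ℝ (⊤ : ℕ∞) ρ (Set.Ioi 0))
    (hρ_nonneg : ∀ u : ℝ, 0 < u → 0 ≤ ρ u)
    (hρ_fe : ∀ u : ℝ, 0 < u → ρ u + ρ (1 / u) = 1)
    (hρ_supp : ∀ u : ℝ, 2 ≤ u → ρ u = 0) :
    (fun T : ℝ =>
        (∑' k : ℕ, ((d3 k : ℝ) * (k : ℝ) ^ (-(1:ℝ)/2) : ℝ) *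
            ∫ t in T..(2 * T), ((ρ (k / (2 * (t / (2 * π)) ^ ((3:ℝ)/2))) : ℝ) : ℂ) *
              (k : ℂ) ^ (-(I * t)) * (chi (1 / 2 + I * t))⁻¹) -
          2 * π * psum (T / (2 * π)) (T / π) (fun k => (d3 k : ℂ)))
      =O[atTop] fun T : ℝ => T ^ ((3:ℝ)/4) * (Real.log T) ^ 2 := by
  obtain ⟨C, hC, hmain⟩ :=
    exists_norm_weightedIntegral_sub_le hρ_smooth hρ_nonneg hρ_fe hρ_supp
  refine Asymptotics.IsBigO.of_bound (100 * C) ?_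
  filter_upwards [eventually_ge_atTop ((10 : ℝ) ^ 4)] with T hT10
  have hT0 : 0 < T := lt_of_lt_of_le (by norm_num) hT10
  set q := T ^ ((1 : ℝ) / 4) with hq
  have hqp : ∀ n : ℕ, q ^ n = T ^ ((n : ℝ) / 4) := fun n => by
    rw [hq, ← Real.rpow_natCast, ← Real.rpow_mul hT0.le]
    congr 1
    ring
  have hT : T = q ^ 4 := by
    rw [hqp]
    norm_num
  have hq0 : 0 < q := by positivity
  have hq10 : 10 ≤ q := by
    refine le_of_pow_le_pow_left₀ (n := 4) (by norm_num) hq0.le ?_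
    rwa [← hT]
  have hq6 : T ^ ((3 : ℝ) / 2) = q ^ 6 := by
    rw [hqp]
    norm_num
  have hq3 : T ^ ((3 : ℝ) / 4) = q ^ 3 := by
    rw [hqp]
    norm_num
  set N := ⌊q ^ 6⌋₊ with hN
  set N₁ := ⌊T⌋₊ with hN₁
  have hNle : (N : ℝ) ≤ q ^ 6 := Nat.floor_le (by positivity)
  have hN₁le : (N₁ : ℝ) ≤ T := Nat.floor_le hT0.le
  have hNlt : q ^ 6 ≤ N + 1 := (Nat.lt_floor_add_one _).le
  have hN₁lt : T ≤ N₁ + 1 := (Nat.lt_floor_add_one _).le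
  have hTN : T ≤ N := by
    have h1 : T + 1 ≤ q ^ 6 := by
      rw [show q ^ 6 = q ^ 2 * q ^ 4 by ring, ← hT]
      nlinarith
    linarith
  have hlogT : Real.log T = 4 * Real.log q := by
    rw [hT, Real.log_pow]
    norm_num
  have hlogq : 1 ≤ Real.log T := by
    rw [Real.le_log_iff_exp_le hT0]
    linarith [Real.exp_one_lt_d9]
  have hL : 1 + Real.log N ≤ 5 / 2 * Real.log T := by
    have := Real.log_le_log (hT0.trans_le hTN) hNle
    rw [Real.log_pow] at this
    push_cast at this
    linarith
  have hL₁ : 1 + Real.log N₁ ≤ 5 / 2 * Real.log T := by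
    have := Real.log_le_log (by linarith : (0 : ℝ) < N₁) hN₁le
    linarith
  have htsum := tsum_weightedIntegral_eq_sum hρ_supp hT0 (N := N) (by rwa [hq6])
  simp only [weightedIntegral, smoothWeight] at htsum
  rw [htsum, psum_eq_sum_endpointWeight hT0 hTN, mul_sum, ← sum_sub_distrib]
  have hterm : ∀ k ∈ Icc 1 N, ‖(d3 k : ℂ) * ((((√(k : ℝ))⁻¹ : ℝ) : ℂ) *
      weightedIntegral ρ T k) - 2 * π * (endpointWeight T k * (d3 k : ℂ))‖ ≤
        (d3 k : ℝ) * (C * (√(k : ℝ))⁻¹ +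
          (if 2 * π * k ≤ 4 * T then C * q * (√(k : ℝ))⁻¹ else 0) +
          if |2 * π * k - T| < q ^ 3 ∨ |2 * π * k - 2 * T| < q ^ 3 then C else 0) :=
    fun k hk => by
      have hk0 : k ≠ 0 := by
        have := (mem_Icc.mp hk).1
        omega
      rw [show (d3 k : ℂ) * ((((√(k : ℝ))⁻¹ : ℝ) : ℂ) * weightedIntegral ρ T k) -
        2 * π * (endpointWeight T k * (d3 k : ℂ)) = (d3 k : ℂ) * ((((√(k : ℝ))⁻¹ : ℝ) : ℂ) *
          weightedIntegral ρ T k - 2 * π * endpointWeight T k) by ring, norm_mul,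
        Complex.norm_natCast]
      exact mul_le_mul_of_nonneg_left (hmain q T hq10 hT k hk0) (by positivity)
  simp only [weightedIntegral, smoothWeight] at hterm
  refine (norm_sum_le_of_le _ hterm).trans ((sum_d3_mul_error_le hC (by linarith) hT hNle hN₁le
    hN₁lt hL hL₁).trans_eq ?_)
  rw [hq3, norm_mul, Real.norm_of_nonneg (by positivity), Real.norm_of_nonneg (by positivity)]
  ring
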